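/- arXiv:0810.3019 — 9 statements merged into one kernel-verified Lean document; each statement's English description precedes it below -/
import Mathlib

section
/- For all integers d ≥ 1, c ≥ 1, and all positive integers a_1,…,a_d, if the volume ∏_{i=1}^d a_i is at most c^{2^d−1}/(e·2^d) (where e is Euler's number), then the grid [a_1,…,a_d] is c-colorable, i.e., there exists a c-coloring of the grid with no monochromatic box. -/
/-- A point of the grid `[a 0, …, a (d-1)]`: one coordinate in `Fin (a i)` for each `i`. -/
def GridPoint (d : ℕ) (a : Fin d → ℕ) : Type := (i : Fin d) → Fin (a i)

/-- A pair `p = (b, c)` with `b i < c i` for all `i` represents a (combinatorial) box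
`∏ i, {b i, c i}`; it is a monochromatic box for the coloring `f` if `f` is constant
on the `2^d` points of the box. -/
def IsMonoBox {d : ℕ} {a : Fin d → ℕ} {c : ℕ} (f : GridPoint d a → Fin c)
    (p : GridPoint d a × GridPoint d a) : Prop :=
  (∀ i, p.1 i < p.2 i) ∧
    ∃ s : Fin c, ∀ x : GridPoint d a, (∀ i, x i = p.1 i ∨ x i = p.2 i) → f x = s

/-- The set of monochromatic boxes of a coloring `f` (each box represented uniquely
by the pair of its coordinatewise-minimal and coordinatewise-maximal corners). -/
def monoBoxSet {d : ℕ} {a : Fin d → ℕ} {c : ℕ} (f : GridPoint d a → Fin c) :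
    Set (GridPoint d a × GridPoint d a) := {p | IsMonoBox f p}

/-- The grid `[a 0, …, a (d-1)]` is `(c,t)`-guaranteed: every `c`-coloring admits at
least `t` distinct monochromatic boxes.  `c`-guaranteed means `(c,1)`-guaranteed. -/
def Guaranteed (d : ℕ) (a : Fin d → ℕ) (c t : ℕ) : Prop :=
  ∀ f : GridPoint d a → Fin c, t ≤ (monoBoxSet f).ncard

section HypergraphColoring

open Finset

variable {V ι κ : Type*} [Fintype V] [DecidableEq V] [Fintype ι] [Fintype κ]

/-- `f` is constant on the vertices of `s`. -/
def IsConstOn (f : V → κ) (s : Finset V) : Prop := ∃ k : κ, ∀ x ∈ s, f x = k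

open Classical in
/-- The colorings of `V` for which no edge contained in `X` is monochromatic. -/
noncomputable def properOn (edge : ι → Finset V) (κ : Type*) [Fintype κ] (X : Finset V) :
    Finset (V → κ) :=
  {f | ∀ e, edge e ⊆ X → ¬ IsConstOn f (edge e)}

open Classical in
/-- The colorings that are proper on `X` and constant on `s`. -/
noncomputable def properConstOn (edge : ι → Finset V) (κ : Type*) [Fintype κ] (X s : Finset V) :
    Finset (V → κ) :=
  {f ∈ properOn edge κ X | IsConstOn f s}

theorem mem_properOn {edge : ι → Finset V} {X : Finset V} {f : V → κ} :
    f ∈ properOn edge κ X ↔ ∀ e, edge e ⊆ X → ¬ IsConstOn f (edge e) := by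
  classical simp [properOn]

theorem mem_properConstOn {edge : ι → Finset V} {X s : Finset V} {f : V → κ} :
    f ∈ properConstOn edge κ X s ↔ f ∈ properOn edge κ X ∧ IsConstOn f s := by
  classical simp [properConstOn]

/-- Recoloring all but one vertex of a monochromatic set `s` arbitrarily keeps a coloring proper
on `X \ s`. -/
theorem card_properConstOn_mul_le (edge : ι → Finset V) (X : Finset V) {s : Finset V} {v : V}
    (hv : v ∈ s) :
    #(properConstOn edge κ X s) * Fintype.card κ ^ (#s - 1) ≤ #(properOn edge κ (X \ s)) := by
  classical
  have hcard : Fintype.card ({x // x ∈ s.erase v} → κ) = Fintype.card κ ^ (#s - 1) := by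
    rw [Fintype.card_fun, Fintype.card_coe, card_erase_of_mem hv]
  rw [← hcard, ← card_univ, ← card_product]
  refine card_le_card_of_injOn
    (fun q x => if hx : x ∈ s.erase v then q.2 ⟨x, hx⟩ else q.1 x) ?_ ?_
  · rintro ⟨f, g⟩ hq
    have hf := mem_properOn.1 (mem_properConstOn.1 (mem_product.1 hq).1).1
    refine mem_properOn.2 fun e he ⟨k, hk⟩ => hf e (he.trans sdiff_subset) ⟨k, fun x hx => ?_⟩
    have hxs : x ∉ s.erase v := fun h => (mem_sdiff.1 (he hx)).2 (mem_of_mem_erase h)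
    simpa [hxs] using hk x hx
  · rintro ⟨f, g⟩ hq ⟨f', g'⟩ hq' h
    obtain ⟨k, hk⟩ := (mem_properConstOn.1 (mem_product.1 hq).1).2
    obtain ⟨k', hk'⟩ := (mem_properConstOn.1 (mem_product.1 hq').1).2
    have off : ∀ x, x ∉ s.erase v → f x = f' x := fun x hx => by
      simpa only [dif_neg hx] using congrFun h x
    have hkk : k = k' := by
      rw [← hk v hv, ← hk' v hv]
      exact off v (notMem_erase v s)
    refine Prod.ext (funext fun x => ?_) (funext fun x => ?_)
    · by_cases hx : x ∈ s
      · exact (hk x hx).trans (hkk.trans (hk' x hx).symm)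
      · exact off x fun h => hx (mem_of_mem_erase h)
    · simpa only [dif_pos x.2] using congrFun h x

open Classical in
theorem card_properOn_le_insert (edge : ι → Finset V) (X : Finset V) (v : V) :
    #(properOn edge κ X) ≤ #(properOn edge κ (insert v X)) +
      ∑ e with v ∈ edge e ∧ edge e ⊆ insert v X, #(properConstOn edge κ X (edge e)) := by
  refine (card_le_card (t := properOn edge κ (insert v X) ∪
    ({e | v ∈ edge e ∧ edge e ⊆ insert v X} : Finset ι).biUnion
      fun e => properConstOn edge κ X (edge e)) fun f hf => ?_).trans
    ((card_union_le _ _).trans (Nat.add_le_add_left card_biUnion_le _))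
  by_cases hg : f ∈ properOn edge κ (insert v X)
  · exact mem_union_left _ hg
  · rw [mem_properOn] at hg
    push Not at hg
    obtain ⟨e, he, hm⟩ := hg
    refine mem_union_right _ (mem_biUnion.2 ⟨e, ?_, mem_properConstOn.2 ⟨hf, hm⟩⟩)
    refine mem_filter.2 ⟨mem_univ _, by_contra fun hv => ?_, he⟩
    exact mem_properOn.1 hf e ((subset_insert_iff_of_notMem hv).1 he) hm

theorem pow_card_sdiff_mul_le {φ : Finset V → ℝ} {r : ℝ} (hr : 0 ≤ r) {Y X : Finset V}
    (hYX : Y ⊆ X)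
    (h : ∀ Z, Z ⊂ X → ∀ v, v ∉ Z → r * φ Z ≤ φ (insert v Z)) :
    r ^ #(X \ Y) * φ Y ≤ φ X := by
  induction X using Finset.strongInduction with
  | H X ih =>
    rcases hYX.eq_or_ssubset with rfl | hss
    · simp
    · obtain ⟨v, hvX, hvY⟩ := exists_of_ssubset hss
      have hZ : X.erase v ⊂ X := erase_ssubset hvX
      have h1 := ih _ hZ (subset_erase.2 ⟨hYX, hvY⟩) fun W hW => h W (hW.trans hZ)
      have h2 := h _ hZ v (notMem_erase v X)
      rw [insert_erase hvX] at h2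
      have h3 : #(X \ Y) = #(X.erase v \ Y) + 1 := by
        rw [erase_sdiff_comm, card_erase_add_one (mem_sdiff.2 ⟨hvX, hvY⟩)]
      calc r ^ #(X \ Y) * φ Y = r * (r ^ #(X.erase v \ Y) * φ Y) := by rw [h3]; ring
        _ ≤ r * φ (X.erase v) := mul_le_mul_of_nonneg_left h1 hr
        _ ≤ φ X := h2

open Classical in
/-- Each further vertex destroys at most a fraction `1 / k` of the proper colorings. -/
theorem mul_card_properOn_le_insert (edge : ι → Finset V) {k : ℕ} (hk : 2 ≤ k) {Δ : ℝ}
    (hcard : ∀ e, #(edge e) = k)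
    (hdeg : ∀ v, (#{e | v ∈ edge e} : ℝ) ≤ Δ)
    (hκ : 0 < Fintype.card κ)
    (hΔ : Δ * k ≤ (Fintype.card κ * (1 - 1 / k : ℝ)) ^ (k - 1))
    (X : Finset V) (v : V) (hv : v ∉ X) :
    (1 - 1 / k : ℝ) * #(properOn edge κ X) ≤ #(properOn edge κ (insert v X)) := by
  induction X using Finset.strongInduction generalizing v with
  | H X ih =>
    have hk0 : (0 : ℝ) < k := by positivity
    have hr : (0 : ℝ) < 1 - 1 / k := by
      rw [sub_pos, div_lt_one hk0]
      exact_mod_cast hk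
    set r : ℝ := 1 - 1 / k with hrdef
    set P : ℝ := (Fintype.card κ * r) ^ (k - 1) with hP
    have hP0 : 0 < P := by positivity
    have hedge : ∀ e ∈ ({e | v ∈ edge e ∧ edge e ⊆ insert v X} : Finset ι),
        (#(properConstOn edge κ X (edge e)) : ℝ) * P ≤ #(properOn edge κ X) := by
      intro e he
      obtain ⟨hve, hsub⟩ := (mem_filter.1 he).2
      have h1 : (#(properConstOn edge κ X (edge e)) : ℝ) * (Fintype.card κ : ℝ) ^ (k - 1) ≤
          #(properOn edge κ (X \ edge e)) := by
        have := card_properConstOn_mul_le (κ := κ) edge X hve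
        rw [hcard] at this
        exact_mod_cast this
      have h2 : #(X \ (X \ edge e)) = k - 1 := by
        have : X \ (X \ edge e) = (edge e).erase v := by
          ext x
          have := @hsub x
          simp only [mem_insert] at this
          simp only [mem_sdiff, mem_erase]
          constructor
          · rintro ⟨hx, hx'⟩
            exact ⟨fun h => hv (h ▸ hx), by tauto⟩
          · tauto
        rw [this, card_erase_of_mem hve, hcard]
      have h3 := pow_card_sdiff_mul_le (φ := fun Y => (#(properOn edge κ Y) : ℝ)) hr.le
        (sdiff_subset : X \ edge e ⊆ X) fun Z hZ w hw => ih Z hZ w hw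
      rw [h2] at h3
      calc _ = r ^ (k - 1) * ((#(properConstOn edge κ X (edge e)) : ℝ) *
            (Fintype.card κ : ℝ) ^ (k - 1)) := by rw [hP, mul_pow]; ring
        _ ≤ _ := (mul_le_mul_of_nonneg_left h1 (by positivity)).trans h3
    have hsum := sum_le_sum hedge
    rw [← sum_mul, sum_const, nsmul_eq_mul] at hsum
    have hcount : (#{e | v ∈ edge e ∧ edge e ⊆ insert v X} : ℝ) ≤ Δ :=
      (Nat.cast_le.2 (card_le_card (monotone_filter_right _ fun e _ he => he.1))).trans (hdeg v)
    have hins : (#(properOn edge κ X) : ℝ) ≤ #(properOn edge κ (insert v X)) +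
        ∑ e with v ∈ edge e ∧ edge e ⊆ insert v X, (#(properConstOn edge κ X (edge e)) : ℝ) := by
      exact_mod_cast card_properOn_le_insert (κ := κ) edge X v
    set N : ℝ := (#(properOn edge κ X) : ℝ) with hN
    set S : ℝ := ∑ e with v ∈ edge e ∧ edge e ⊆ insert v X,
      (#(properConstOn edge κ X (edge e)) : ℝ)
    have hN0 : 0 ≤ N := Nat.cast_nonneg _
    have hS : S ≤ 1 / k * N := by
      rw [div_mul_eq_mul_div, one_mul, le_div_iff₀ hk0]
      refine le_of_mul_le_mul_right ?_ hP0
      calc S * k * P = S * P * k := by ring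
        _ ≤ Δ * N * k :=
          mul_le_mul_of_nonneg_right (hsum.trans (mul_le_mul_of_nonneg_right hcount hN0)) hk0.le
        _ = Δ * k * N := by ring
        _ ≤ P * N := mul_le_mul_of_nonneg_right hΔ hN0
        _ = N * P := mul_comm _ _
    rw [hrdef, sub_mul, one_mul]
    linarith

theorem one_le_exp_one_mul_one_sub_inv_pow {k : ℕ} (hk : 2 ≤ k) :
    1 ≤ Real.exp 1 * (1 - 1 / k : ℝ) ^ (k - 1) := by
  obtain ⟨n, rfl⟩ : ∃ n, k = n + 1 := ⟨k - 1, by omega⟩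
  have hn : (0 : ℝ) < n := by exact_mod_cast (by omega : 0 < n)
  have h : (1 : ℝ) - 1 / ((n + 1 : ℕ) : ℝ) = (1 + 1 / n : ℝ)⁻¹ := by
    push_cast
    field_simp
    ring
  have hexp : (1 + 1 / n : ℝ) ^ n ≤ Real.exp 1 := by
    calc (1 + 1 / n : ℝ) ^ n ≤ Real.exp (1 / n) ^ n := by
          gcongr
          linarith [Real.add_one_le_exp (1 / n : ℝ)]
      _ = Real.exp 1 := by
          rw [← Real.exp_nat_mul]
          congr 1
          field_simp
  rw [h, Nat.add_sub_cancel, inv_pow, ← div_eq_mul_inv, one_le_div (by positivity)]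
  exact hexp

open Classical in
/-- A `k`-uniform hypergraph of maximum degree `Δ` has a proper coloring with colors `κ` whenever
`e * Δ * k ≤ |κ| ^ (k - 1)`. -/
theorem exists_coloring_of_uniform (edge : ι → Finset V) {k : ℕ} (hk : 2 ≤ k) {Δ : ℝ}
    (hcard : ∀ e, #(edge e) = k)
    (hdeg : ∀ v, (#{e | v ∈ edge e} : ℝ) ≤ Δ)
    (hκ : 0 < Fintype.card κ)
    (hΔ : Δ ≤ (Fintype.card κ : ℝ) ^ (k - 1) / (Real.exp 1 * k)) :
    ∃ f : V → κ, ∀ e, ¬ IsConstOn f (edge e) := by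
  have hk0 : (0 : ℝ) < k := by positivity
  have hr : (0 : ℝ) < 1 - 1 / k := by
    rw [sub_pos, div_lt_one hk0]
    exact_mod_cast hk
  have hΔ' : Δ * k ≤ (Fintype.card κ * (1 - 1 / k : ℝ)) ^ (k - 1) := by
    rw [le_div_iff₀ (by positivity)] at hΔ
    refine le_of_mul_le_mul_left ?_ (Real.exp_pos 1)
    calc Real.exp 1 * (Δ * k) = Δ * (Real.exp 1 * k) := by ring
      _ ≤ (Fintype.card κ : ℝ) ^ (k - 1) := hΔ
      _ ≤ (Fintype.card κ : ℝ) ^ (k - 1) * (Real.exp 1 * (1 - 1 / k : ℝ) ^ (k - 1)) :=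
        le_mul_of_one_le_right (by positivity) (one_le_exp_one_mul_one_sub_inv_pow hk)
      _ = _ := by rw [mul_pow]; ring
  have hempty : 0 < #(properOn edge κ ∅) := by
    obtain ⟨c⟩ := Fintype.card_pos_iff.1 hκ
    refine card_pos.2 ⟨fun _ => c, mem_properOn.2 fun e he => ?_⟩
    have := hcard e
    rw [subset_empty.1 he, card_empty] at this
    omega
  have huniv := pow_card_sdiff_mul_le (φ := fun Y => (#(properOn edge κ Y) : ℝ)) hr.le
    (empty_subset univ) fun Z _ => mul_card_properOn_le_insert edge hk hcard hdeg hκ hΔ' Z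
  have hpos : (0 : ℝ) < #(properOn edge κ univ) :=
    lt_of_lt_of_le (mul_pos (pow_pos hr _) (Nat.cast_pos.2 hempty)) huniv
  obtain ⟨f, hf⟩ := card_pos.1 (Nat.cast_pos.1 hpos)
  exact ⟨f, fun e => mem_properOn.1 hf e (subset_univ _)⟩

end HypergraphColoring

section Boxes

open Finset

variable {d : ℕ} {a : Fin d → ℕ}

instance : Fintype (GridPoint d a) := inferInstanceAs (Fintype ((i : Fin d) → Fin (a i)))

instance : DecidableEq (GridPoint d a) :=
  inferInstanceAs (DecidableEq ((i : Fin d) → Fin (a i)))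

theorem card_gridPoint : Fintype.card (GridPoint d a) = ∏ i, a i :=
  (Fintype.card_pi (α := fun i : Fin d => Fin (a i))).trans (by simp)

/-- The vertices of the box with opposite corners `p.1` and `p.2`. -/
def boxVertices (p : GridPoint d a × GridPoint d a) : Finset (GridPoint d a) :=
  Fintype.piFinset fun i => {p.1 i, p.2 i}

theorem mem_boxVertices {p : GridPoint d a × GridPoint d a} {x : GridPoint d a} :
    x ∈ boxVertices p ↔ ∀ i, x i = p.1 i ∨ x i = p.2 i := by
  refine Fintype.mem_piFinset.trans ?_
  simp

theorem card_boxVertices {p : GridPoint d a × GridPoint d a} (hp : ∀ i, p.1 i < p.2 i) :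
    #(boxVertices p) = 2 ^ d := by
  refine (Fintype.card_piFinset _).trans ?_
  simp [card_pair (hp _).ne]

open Classical in
/-- A box is determined by one of its vertices and the opposite vertex. -/
theorem card_boxes_through_le (x : GridPoint d a) :
    #{p : {p : GridPoint d a × GridPoint d a // ∀ i, p.1 i < p.2 i} | x ∈ boxVertices p.1} ≤
      Fintype.card (GridPoint d a) := by
  rw [← card_univ]
  refine card_le_card_of_injOn
    (fun p i => if x i = p.1.1 i then p.1.2 i else p.1.1 i) (fun _ _ => mem_univ _) ?_
  rintro ⟨⟨b, c⟩, hp⟩ hx ⟨⟨b', c'⟩, hp'⟩ hx' h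
  have hx := mem_boxVertices.1 (mem_filter.1 hx).2
  have hx' := mem_boxVertices.1 (mem_filter.1 hx').2
  have key : ∀ i, b i = b' i ∧ c i = c' i := fun i => by
    have h1 := hx i
    have h2 := hx' i
    have h3 := congrFun h i
    have h4 := hp i
    have h5 := hp' i
    dsimp only at h1 h2 h3 h4 h5
    grind
  exact Subtype.ext (Prod.ext (funext fun i => (key i).1) (funext fun i => (key i).2))

end Boxes

/-- any grid of volume at most `c^(2^d - 1) / (e * 2^d)` is `c`-colorable. -/
theorem small_grids_colorable (d c : ℕ) (hd : 1 ≤ d) (hc : 1 ≤ c)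
    (a : Fin d → ℕ) (ha : ∀ i, 1 ≤ a i)
    (hvol : (∏ i, (a i : ℝ)) ≤ (c : ℝ) ^ (2 ^ d - 1) / (Real.exp 1 * 2 ^ d)) :
    ∃ f : GridPoint d a → Fin c, ∀ p, ¬ IsMonoBox f p := by
  classical
  obtain ⟨f, hf⟩ := exists_coloring_of_uniform (κ := Fin c) (k := 2 ^ d) (Δ := ∏ i, (a i : ℝ))
    (fun p : {p : GridPoint d a × GridPoint d a // ∀ i, p.1 i < p.2 i} => boxVertices p.1)
    (le_self_pow₀ one_le_two (by omega)) (fun p => card_boxVertices p.2)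
    (fun x => by
      have := card_boxes_through_le x
      rw [card_gridPoint] at this
      exact_mod_cast this)
    (by rwa [Fintype.card_fin]) (by simpa using hvol)
  exact ⟨f, fun p ⟨hp, s, hs⟩ => hf ⟨p, hp⟩ ⟨s, fun x hx => hs x (mem_boxVertices.1 hx)⟩⟩
end

section
/- Fix integers c ≥ 1 and d ≥ 1. For every real δ > 0 there exists an integer N such that: for all integers a_1,…,a_d ≥ N, setting M = ∏_{i=1}^d binom(a_i, 2) (the total number of boxes in the grid), every c-coloring of the grid [a_1,…,a_d] admits at least (1−δ)·M/c^{2^d−1} monochromatic boxes. -/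
open Finset

/-- The corner of the box spanned by `p` and `q` that is selected by `ω`. -/
def boxCorner {d : ℕ} {α : Fin d → Type*} (ω : Fin d → Bool) (p q : ∀ i, α i) : ∀ i, α i :=
  fun i => bif ω i then p i else q i

lemma boxCorner_cons {d : ℕ} {α : Fin (d + 1) → Type*} (b : Bool) (ω : Fin d → Bool)
    (x y : α 0) (p q : ∀ i : Fin d, α i.succ) :
    boxCorner (Fin.cons b ω : Fin (d + 1) → Bool) (Fin.cons x p) (Fin.cons y q) =
      (Fin.cons (bif b then x else y) (boxCorner ω p q) : ∀ i, α i) := by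
  funext i
  refine Fin.cases ?_ (fun j => ?_) i <;> simp [boxCorner]

/-- The number of boxes, possibly degenerate and with ordered corners, weighted by `g`. -/
def weightedBoxCount {d : ℕ} {α : Fin d → Type*} [∀ i, Fintype (α i)]
    (g : (∀ i, α i) → ℝ) : ℝ :=
  ∑ p : ∀ i, α i, ∑ q : ∀ i, α i, ∏ ω : Fin d → Bool, g (boxCorner ω p q)

lemma weightedBoxCount_eq_sum_prod {d : ℕ} {α : Fin d → Type*} [∀ i, Fintype (α i)]
    (g : (∀ i, α i) → ℝ) :
    weightedBoxCount g =
      ∑ w : (∀ i, α i) × (∀ i, α i), ∏ ω : Fin d → Bool, g (boxCorner ω w.1 w.2) := by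
  rw [Fintype.sum_prod_type, weightedBoxCount]

lemma sum_pi_cons {d : ℕ} {α : Fin (d + 1) → Type*} [∀ i, Fintype (α i)]
    (F : (∀ i, α i) → ℝ) :
    ∑ p, F p = ∑ x : α 0, ∑ p : ∀ i : Fin d, α i.succ, F (Fin.cons x p) := by
  rw [← (Fin.consEquiv α).sum_comp, Fintype.sum_prod_type]
  rfl

lemma prod_bool_cons {d : ℕ} (F : (Fin (d + 1) → Bool) → ℝ) :
    ∏ ω, F ω = ∏ ω : Fin d → Bool, F (Fin.cons true ω) * F (Fin.cons false ω) := by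
  rw [← (Fin.consEquiv fun _ => Bool).prod_comp, Fintype.prod_prod_type, Fintype.prod_bool,
    ← prod_mul_distrib]
  rfl

lemma weightedBoxCount_succ {d : ℕ} {α : Fin (d + 1) → Type*} [∀ i, Fintype (α i)]
    (g : (∀ i, α i) → ℝ) :
    weightedBoxCount g = ∑ x : α 0, ∑ y : α 0, weightedBoxCount
      (fun z : ∀ i : Fin d, α i.succ => g (Fin.cons x z) * g (Fin.cons y z)) := by
  simp only [weightedBoxCount]
  rw [sum_pi_cons]
  refine sum_congr rfl fun x _ => ?_
  rw [sum_comm]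
  simp only [sum_pi_cons (d := d)]
  refine sum_congr rfl fun y _ => ?_
  rw [sum_comm]
  refine sum_congr rfl fun p _ => sum_congr rfl fun q _ => ?_
  rw [prod_bool_cons]
  simp only [boxCorner_cons, cond_true, cond_false]

/-- Power mean inequality, multiplied out. -/
lemma pow_sum_mul_card_le {ι : Type*} [Fintype ι] (n : ℕ) (hn : n ≠ 0) (F : ι → ℝ)
    (hF : ∀ i, 0 ≤ F i) :
    (∑ i, F i) ^ n * Fintype.card ι ≤ (∑ i, F i ^ n) * (Fintype.card ι : ℝ) ^ n := by
  obtain ⟨m, rfl⟩ := Nat.exists_eq_succ_of_ne_zero hn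
  rcases isEmpty_or_nonempty ι with hι | hι
  · simp
  have hpos : (0 : ℝ) < Fintype.card ι := by exact_mod_cast Fintype.card_pos
  have h := pow_sum_div_card_le_sum_pow (s := univ) (f := F) (fun i _ => hF i) m
  rw [card_univ, div_le_iff₀ (by positivity)] at h
  rw [pow_succ (Fintype.card ι : ℝ), ← mul_assoc]
  gcongr

/-- Sidorenko's inequality for boxes: the weighted number of boxes is at least what it would be
for a constant weight with the same total. -/
lemma sum_pow_le_weightedBoxCount {d : ℕ} {α : Fin d → Type*} [∀ i, Fintype (α i)]
    (g : (∀ i, α i) → ℝ) (hg : ∀ z, 0 ≤ g z) :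
    (∑ z, g z) ^ 2 ^ d * (Fintype.card (∀ i, α i) : ℝ) ^ 2 ≤
      weightedBoxCount g * (Fintype.card (∀ i, α i) : ℝ) ^ 2 ^ d := by
  induction d with
  | zero => simp [weightedBoxCount, Subsingleton.elim _ (default : ∀ i, α i)]
  | succ d ih =>
    set V : ℝ := (Fintype.card (∀ i : Fin d, α i.succ) : ℝ) with hV
    set A : ℝ := (Fintype.card (α 0) : ℝ) with hA
    have hcard : (Fintype.card (∀ i, α i) : ℝ) = A * V := by
      rw [← Fintype.card_congr (Fin.consEquiv α), Fintype.card_prod]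
      push_cast
      rfl
    let h : α 0 × α 0 → ℝ := fun w =>
      ∑ z : ∀ i : Fin d, α i.succ, g (Fin.cons w.1 z) * g (Fin.cons w.2 z)
    have h0 : ∀ w, 0 ≤ h w := fun w => sum_nonneg fun z _ => mul_nonneg (hg _) (hg _)
    have hsum : (∑ z, g z) ^ 2 ≤ V * ∑ w, h w := by
      have e1 : ∑ z, g z = ∑ z : ∀ i : Fin d, α i.succ, ∑ x, g (Fin.cons x z) := by
        rw [sum_pi_cons, sum_comm]
      have e2 : ∑ w, h w = ∑ z : ∀ i : Fin d, α i.succ, (∑ x, g (Fin.cons x z)) ^ 2 := by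
        simp only [h]
        rw [sum_comm]
        refine sum_congr rfl fun z _ => ?_
        rw [Fintype.sum_prod_type, sq, sum_mul_sum]
      rw [e1, e2]
      exact sq_sum_le_card_mul_sum_sq
    have hpm := pow_sum_mul_card_le (2 ^ d) (by positivity) h h0
    rw [Fintype.card_prod] at hpm
    push_cast at hpm
    rw [← hA] at hpm
    have hbox : (∑ w, h w ^ 2 ^ d) * V ^ 2 ≤ weightedBoxCount g * V ^ 2 ^ d := by
      rw [weightedBoxCount_succ, ← Fintype.sum_prod_type', sum_mul, sum_mul]
      exact sum_le_sum fun w _ => ih _ fun z => mul_nonneg (hg _) (hg _)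
    rw [hcard]
    have hV0 : 0 ≤ V := by positivity
    have hA0 : 0 ≤ A := by positivity
    calc (∑ z, g z) ^ 2 ^ (d + 1) * (A * V) ^ 2
        = ((∑ z, g z) ^ 2) ^ 2 ^ d * (A * V) ^ 2 := by rw [← pow_mul, pow_succ' 2 d]
      _ ≤ (V * ∑ w, h w) ^ 2 ^ d * (A * V) ^ 2 := by gcongr
      _ = ((∑ w, h w) ^ 2 ^ d * (A * A)) * (V ^ 2 ^ d * V ^ 2) := by ring
      _ ≤ ((∑ w, h w ^ 2 ^ d) * (A * A) ^ 2 ^ d) * (V ^ 2 ^ d * V ^ 2) := by gcongr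
      _ = ((∑ w, h w ^ 2 ^ d) * V ^ 2) * ((A * A) ^ 2 ^ d * V ^ 2 ^ d) := by ring
      _ ≤ (weightedBoxCount g * V ^ 2 ^ d) * ((A * A) ^ 2 ^ d * V ^ 2 ^ d) := by gcongr
      _ = weightedBoxCount g * (A * V) ^ 2 ^ (d + 1) := by
        rw [pow_succ' 2 d, pow_mul]
        ring

/-- The box spanned by `p` and `q`, which may be degenerate, is monochromatic for `f`. -/
def MonoCorners {d : ℕ} {α : Fin d → Type*} {κ : Type*} (f : (∀ i, α i) → κ)
    (w : (∀ i, α i) × (∀ i, α i)) : Prop :=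
  ∀ ω, f (boxCorner ω w.1 w.2) = f w.1

open Classical in
/-- Among all ordered pairs of points, at least a `1 / c ^ (2 ^ d - 1)` proportion spans a
possibly degenerate monochromatic box. -/
lemma sq_card_le_card_monoCorners {d c : ℕ} {α : Fin d → Type*}
    [∀ i, Fintype (α i)] [∀ i, Nonempty (α i)] (hc : 1 ≤ c) (f : (∀ i, α i) → Fin c) :
    (Fintype.card (∀ i, α i) : ℝ) ^ 2 ≤
      (#{w | MonoCorners f w} : ℝ) * (c : ℝ) ^ (2 ^ d - 1) := by
  set V : ℝ := (Fintype.card (∀ i, α i) : ℝ) with hV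
  have hV0 : 0 < V := by
    rw [hV]
    exact_mod_cast Fintype.card_pos
  let g : Fin c → (∀ i, α i) → ℝ := fun s z => if f z = s then 1 else 0
  have g0 : ∀ s z, 0 ≤ g s z := fun s z => by positivity
  have hcount : ∑ s, weightedBoxCount (g s) ≤ (#{w | MonoCorners f w} : ℝ) := by
    simp only [weightedBoxCount_eq_sum_prod]
    rw [sum_comm, card_filter]
    push_cast
    refine sum_le_sum fun w _ => ?_
    simp only [g, prod_boole, mem_univ, true_imp_iff]
    have hself : boxCorner (fun _ => true) w.1 w.2 = w.1 := rfl
    split_ifs with hw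
    · calc (∑ s, if ∀ ω, f (boxCorner ω w.1 w.2) = s then (1 : ℝ) else 0)
          ≤ ∑ s, if f w.1 = s then (1 : ℝ) else 0 := by
            refine sum_le_sum fun s _ => ?_
            split_ifs with h1 h2
            exacts [le_rfl, absurd (h1 fun _ => true) h2, zero_le_one, le_rfl]
        _ ≤ 1 := by simp
    · refine (sum_eq_zero fun s _ => if_neg fun h => hw fun ω => ?_).le
      rw [h ω, ← h (fun _ => true), hself]
  have htotal : ∑ s, ∑ z, g s z = V := by
    rw [sum_comm]
    simp [g, hV]
  have hpm := pow_sum_mul_card_le (2 ^ d) (by positivity) (fun s => ∑ z, g s z)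
    fun s => sum_nonneg fun z _ => g0 s z
  rw [htotal, Fintype.card_fin] at hpm
  have hbox : (∑ s, (∑ z, g s z) ^ 2 ^ d) * V ^ 2 ≤ (∑ s, weightedBoxCount (g s)) * V ^ 2 ^ d := by
    rw [sum_mul, sum_mul]
    exact sum_le_sum fun s _ => sum_pow_le_weightedBoxCount _ (g0 s)
  have hc0 : (0 : ℝ) < c := by exact_mod_cast hc
  have hpow : (c : ℝ) ^ 2 ^ d = c ^ (2 ^ d - 1) * c := by
    rw [← pow_succ, Nat.sub_add_cancel Nat.one_le_two_pow]
  rw [hpow, ← mul_assoc] at hpm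
  have hpm' := le_of_mul_le_mul_right hpm hc0
  refine le_of_mul_le_mul_left ?_ (pow_pos hV0 (2 ^ d))
  calc V ^ 2 ^ d * V ^ 2 ≤ ((∑ s, (∑ z, g s z) ^ 2 ^ d) * c ^ (2 ^ d - 1)) * V ^ 2 := by gcongr
    _ = ((∑ s, (∑ z, g s z) ^ 2 ^ d) * V ^ 2) * c ^ (2 ^ d - 1) := by ring
    _ ≤ ((#{w | MonoCorners f w} : ℝ) * V ^ 2 ^ d) * c ^ (2 ^ d - 1) := by
      gcongr ?_ * _
      exact hbox.trans (by gcongr)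
    _ = _ := by ring

lemma card_filter_eq_at_mul_card_le {ι : Type*} [Fintype ι] [DecidableEq ι] {α : ι → Type*}
    [∀ i, Fintype (α i)] [∀ i, DecidableEq (α i)] (i : ι) :
    #{w : (∀ i, α i) × (∀ i, α i) | w.1 i = w.2 i} * Fintype.card (α i) ≤
      Fintype.card (∀ i, α i) ^ 2 := by
  rw [← card_univ (α := α i), ← card_product, sq, ← Fintype.card_prod, ← card_univ]
  refine card_le_card_of_injOn (fun t => (t.1.1, Function.update t.1.2 i t.2))
    (fun _ _ => mem_coe.2 (mem_univ _)) ?_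
  rintro ⟨⟨p, q⟩, x⟩ h ⟨⟨p', q'⟩, x'⟩ h' heq
  simp only [coe_product, Set.mem_prod, mem_coe, mem_filter, mem_univ, true_and, and_true] at h h'
  simp only [Prod.mk.injEq] at heq ⊢
  obtain ⟨rfl, hq⟩ := heq
  refine ⟨⟨rfl, funext fun j => ?_⟩, by simpa using congrFun hq i⟩
  by_cases hj : j = i
  · subst hj
    rw [← h, ← h']
  · simpa [hj] using congrFun hq j

open Classical in
/-- Every nondegenerate monochromatic box is spanned by at most `2 ^ d` ordered pairs. -/
lemma card_nondegenerate_monoCorners_le {d c : ℕ} {a : Fin d → ℕ} (f : GridPoint d a → Fin c) :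
    #{w : (∀ i, Fin (a i)) × (∀ i, Fin (a i)) | MonoCorners f w ∧ ∀ i, w.1 i ≠ w.2 i} ≤
      (monoBoxSet f).ncard * 2 ^ d := by
  have hfin : Finite (GridPoint d a × GridPoint d a) :=
    inferInstanceAs (Finite ((∀ i, Fin (a i)) × (∀ i, Fin (a i))))
  have hcard : (monoBoxSet f ×ˢ (Set.univ : Set (Fin d → Bool))).ncard =
      (monoBoxSet f).ncard * 2 ^ d := by
    rw [Set.ncard_prod, Set.ncard_univ]
    simp
  rw [← hcard, ← Set.ncard_coe_finset]
  refine Set.ncard_le_ncard_of_injOn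
    (fun w => ((fun i => min (w.1 i) (w.2 i), fun i => max (w.1 i) (w.2 i)),
      fun i => decide (w.1 i ≤ w.2 i))) ?_ ?_ (Set.toFinite _)
  · rintro ⟨p, q⟩ hw
    simp only [coe_filter, mem_univ, true_and, Set.mem_ofPred_eq] at hw
    refine ⟨⟨fun i => min_lt_max.2 (hw.2 i), f p, fun x hx => ?_⟩, Set.mem_univ _⟩
    have hx' : x = boxCorner (fun i => decide (x i = p i)) p q := by
      funext i
      have := hx i
      by_cases h : x i = p i
      · simp [boxCorner, h]
      · rcases le_total (p i) (q i) with hpq | hpq <;> simp_all [boxCorner]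
    rw [hx']
    exact hw.1 _
  · rintro ⟨p, q⟩ - ⟨p', q'⟩ - heq
    obtain ⟨hcorners, hle⟩ := Prod.mk.inj heq
    obtain ⟨hmin, hmax⟩ := Prod.mk.inj hcorners
    have key : ∀ i, p i = p' i ∧ q i = q' i := fun i => by
      have h1 := congrFun hmin i
      have h2 := congrFun hmax i
      have h3 := congrFun hle i
      simp only [decide_eq_decide] at h3
      rcases le_total (p i) (q i) with h | h <;> rcases le_total (p' i) (q' i) with h' | h' <;>
        simp_all <;> grind
    exact Prod.ext (funext fun i => (key i).1) (funext fun i => (key i).2)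

open Classical in
lemma card_monoCorners_le {d c N : ℕ} (hN : 0 < N) {a : Fin d → ℕ} (ha : ∀ i, N ≤ a i)
    (f : GridPoint d a → Fin c) :
    (#{w : (∀ i, Fin (a i)) × (∀ i, Fin (a i)) | MonoCorners f w} : ℝ) ≤
      (monoBoxSet f).ncard * 2 ^ d + d * ((∏ i, (a i : ℝ)) ^ 2 / N) := by
  have hsub : ({w | MonoCorners f w} : Finset ((∀ i, Fin (a i)) × (∀ i, Fin (a i)))) ⊆
      ({w | MonoCorners f w ∧ ∀ i, w.1 i ≠ w.2 i} : Finset _) ∪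
        univ.biUnion fun i => ({w | w.1 i = w.2 i} : Finset _) := by
    intro w hw
    simp only [mem_filter, mem_univ, true_and, mem_union, mem_biUnion] at hw ⊢
    by_cases h : ∀ i, w.1 i ≠ w.2 i
    · exact Or.inl ⟨hw, h⟩
    · push Not at h
      exact Or.inr h
  have h1 := (card_le_card hsub).trans ((card_union_le _ _).trans
    (add_le_add (card_nondegenerate_monoCorners_le f) card_biUnion_le))
  have h2 : ∀ i, (#{w : (∀ i, Fin (a i)) × (∀ i, Fin (a i)) | w.1 i = w.2 i} : ℝ) ≤
      (∏ i, (a i : ℝ)) ^ 2 / N := fun i => by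
    rw [le_div_iff₀ (by exact_mod_cast hN)]
    have h := card_filter_eq_at_mul_card_le (α := fun i => Fin (a i)) i
    simp only [Fintype.card_pi, Fintype.card_fin] at h
    exact_mod_cast (Nat.mul_le_mul_left _ (ha i)).trans h
  calc _ ≤ ((monoBoxSet f).ncard * 2 ^ d : ℝ) +
        ∑ i, (#{w : (∀ i, Fin (a i)) × (∀ i, Fin (a i)) | w.1 i = w.2 i} : ℝ) := by
        exact_mod_cast h1
    _ ≤ _ := by
      gcongr
      refine (sum_le_sum fun i _ => h2 i).trans ?_
      simp

lemma two_pow_mul_prod_choose_two_le {d : ℕ} (a : Fin d → ℕ) :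
    2 ^ d * ∏ i, ((a i).choose 2 : ℝ) ≤ (∏ i, (a i : ℝ)) ^ 2 := by
  have h : (2 : ℝ) ^ d = ∏ _i : Fin d, (2 : ℝ) := by simp
  rw [h, ← prod_mul_distrib, ← prod_pow]
  refine prod_le_prod (fun i _ => by positivity) fun i _ => ?_
  rw [Nat.cast_choose_two]
  nlinarith [Nat.cast_nonneg (α := ℝ) (a i)]

/-- for `min a_i → ∞`, every `c`-coloring of `[a_1,…,a_d]` admits at least
`(1 - δ) * M / c^(2^d - 1)` monochromatic boxes, where `M = ∏ (a_i choose 2)`. -/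
theorem many_mono_boxes (c d : ℕ) (hc : 1 ≤ c) (hd : 1 ≤ d) (δ : ℝ) (hδ : 0 < δ) :
    ∃ N : ℕ, ∀ a : Fin d → ℕ, (∀ i, N ≤ a i) →
      ∀ f : GridPoint d a → Fin c,
        (1 - δ) * (∏ i, ((a i).choose 2 : ℝ)) / (c : ℝ) ^ (2 ^ d - 1)
          ≤ ((monoBoxSet f).ncard : ℝ) := by
  set C : ℝ := (c : ℝ) ^ (2 ^ d - 1) with hC
  have hC0 : 0 < C := pow_pos (by exact_mod_cast hc) _
  obtain ⟨N, hN⟩ := exists_nat_gt (d * C / δ)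
  have hNpos : (0 : ℝ) < N := lt_of_le_of_lt (by positivity) hN
  refine ⟨N, fun a ha f => ?_⟩
  rw [div_le_iff₀ hC0]
  have hM : 0 ≤ ∏ i, ((a i).choose 2 : ℝ) := prod_nonneg fun i _ => by positivity
  rcases le_total 1 δ with hδ1 | hδ1
  · exact (mul_nonpos_of_nonpos_of_nonneg (by linarith) hM).trans (by positivity)
  have hN' : 0 < N := by exact_mod_cast hNpos
  have hne : ∀ i, Nonempty (Fin (a i)) := fun i => ⟨⟨0, hN'.trans_le (ha i)⟩⟩
  have h1 := sq_card_le_card_monoCorners (α := fun i => Fin (a i)) hc f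
  have h2 := card_monoCorners_le hN' ha f
  have h3 := two_pow_mul_prod_choose_two_le a
  simp only [Fintype.card_pi, Fintype.card_fin, Nat.cast_prod] at h1
  set W : ℝ := (∏ i, (a i : ℝ)) ^ 2 with hW
  have hW0 : 0 ≤ W := sq_nonneg _
  rw [← hC] at h1
  have herr : d * (W / N) * C ≤ δ * W := by
    rw [div_lt_iff₀ hδ] at hN
    rw [← mul_div_assoc, div_mul_eq_mul_div, div_le_iff₀ hNpos]
    nlinarith
  refine le_of_mul_le_mul_left ?_ (by positivity : (0 : ℝ) < 2 ^ d)
  have h4 := mul_le_mul_of_nonneg_right h2 hC0.le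
  have h5 := mul_le_mul_of_nonneg_left h3 (sub_nonneg.2 hδ1)
  linarith
end

section
/- Let c ≥ 1, d ≥ 1 be integers and a_1,…,a_d ≥ 2 be integers, and set M = ∏_{i=1}^d binom(a_i,2). Define real numbers Δ_0,…,Δ_d by the recurrence Δ_0 = 1 and Δ_j = Δ_{j−1}^2 · (1 − (c^{2^{j−1}}/Δ_{j−1} − 1)/(a_j − 1)). If Δ_1,…,Δ_d are all positive, then every c-coloring of the grid [a_1,…,a_d] admits at least M·Δ_d/c^{2^d−1} monochromatic boxes. -/
open Finset

instance GridPoint.instFintype (d : ℕ) (a : Fin d → ℕ) : Fintype (GridPoint d a) :=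
  inferInstanceAs (Fintype ((i : Fin d) → Fin (a i)))

/-- Append a last coordinate to a grid point. -/
def GridPoint.snoc {d : ℕ} {a : Fin (d + 1) → ℕ} (x : GridPoint d (fun i => a i.castSucc))
    (k : Fin (a (Fin.last d))) : GridPoint (d + 1) a :=
  Fin.snoc (α := fun i => Fin (a i)) x k

@[simp]
lemma GridPoint.snoc_castSucc {d : ℕ} {a : Fin (d + 1) → ℕ}
    (x : GridPoint d (fun i => a i.castSucc)) (k : Fin (a (Fin.last d))) (i : Fin d) :
    GridPoint.snoc x k i.castSucc = x i :=
  Fin.snoc_castSucc (α := fun i => Fin (a i)) k x i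

@[simp]
lemma GridPoint.snoc_last {d : ℕ} {a : Fin (d + 1) → ℕ}
    (x : GridPoint d (fun i => a i.castSucc)) (k : Fin (a (Fin.last d))) :
    GridPoint.snoc x k (Fin.last d) = k :=
  Fin.snoc_last (α := fun i => Fin (a i)) k x

/-- The box with corners `p.1`, `p.2` has constant color `s`. -/
def HasColor {d : ℕ} {a : Fin d → ℕ} {c : ℕ} (f : GridPoint d a → Fin c)
    (p : GridPoint d a × GridPoint d a) (s : Fin c) : Prop :=
  ∀ x : GridPoint d a, (∀ i, x i = p.1 i ∨ x i = p.2 i) → f x = s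

lemma HasColor.eq {d : ℕ} {a : Fin d → ℕ} {c : ℕ} {f : GridPoint d a → Fin c}
    {p : GridPoint d a × GridPoint d a} {s t : Fin c} (hs : HasColor f p s)
    (ht : HasColor f p t) : s = t :=
  (hs p.1 fun _ => Or.inl rfl).symm.trans (ht p.1 fun _ => Or.inl rfl)

lemma two_mul_card_filter_lt {α : Type*} [LinearOrder α] (s : Finset α) :
    (2 : ℝ) * ((s ×ˢ s).filter fun q => q.1 < q.2).card = (s.card : ℝ) * (s.card - 1) := by
  have hswap : ((s ×ˢ s).filter fun q => q.1 < q.2).card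
      = ((s ×ˢ s).filter fun q => q.2 < q.1).card :=
    card_bij (fun q _ => q.swap) (by simp +contextual) (by simp +contextual)
      (fun q hq => ⟨q.swap, by simp_all, by simp⟩)
  have hunion : s.offDiag = ((s ×ˢ s).filter fun q => q.1 < q.2) ∪
      ((s ×ˢ s).filter fun q => q.2 < q.1) := by
    ext q
    simp only [mem_offDiag, mem_union, mem_filter, mem_product, ne_iff_lt_or_gt]
    tauto
  have hdisj : Disjoint ((s ×ˢ s).filter fun q => q.1 < q.2)
      ((s ×ˢ s).filter fun q => q.2 < q.1) :=
    disjoint_filter.2 fun q _ h => h.asymm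
  have hcard : s.offDiag.card + s.card = s.card * s.card := by
    rw [offDiag_card]
    exact Nat.sub_add_cancel (Nat.le_mul_self _)
  rw [hunion, card_union_of_disjoint hdisj, ← hswap] at hcard
  have : (_ : ℝ) = _ := congrArg (Nat.cast (R := ℝ)) hcard
  push_cast at this
  linarith

open Classical in
lemma card_boxes_le (d : ℕ) (a : Fin d → ℕ) :
    ((univ.filter fun p : GridPoint d a × GridPoint d a => ∀ i, p.1 i < p.2 i).card : ℝ)
      ≤ ∏ i, ((a i).choose 2 : ℝ) := by
  have hle : (univ.filter fun p : GridPoint d a × GridPoint d a => ∀ i, p.1 i < p.2 i).card ≤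
      (Fintype.piFinset fun i => (univ ×ˢ univ : Finset (Fin (a i) × Fin (a i))).filter
        fun q => q.1 < q.2).card := by
    refine card_le_card_of_injOn (fun p i => (p.1 i, p.2 i)) ?_ ?_
    · intro p hp
      simpa using hp
    · intro p _ q _ h
      have h' := fun i => Prod.ext_iff.1 (congrFun h i)
      exact Prod.ext (funext fun i => (h' i).1) (funext fun i => (h' i).2)
  rw [Fintype.card_piFinset] at hle
  refine (Nat.cast_le.2 hle).trans (le_of_eq ?_)
  push_cast
  refine prod_congr rfl fun i _ => ?_
  have := two_mul_card_filter_lt (univ : Finset (Fin (a i)))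
  rw [card_univ, Fintype.card_fin] at this
  rw [Nat.cast_choose_two]
  linarith

lemma IsMonoBox.snoc {d : ℕ} {a : Fin (d + 1) → ℕ} {c : ℕ} {f : GridPoint (d + 1) a → Fin c}
    {p : GridPoint d (fun i => a i.castSucc) × GridPoint d (fun i => a i.castSucc)}
    (hp : ∀ i, p.1 i < p.2 i) {k l : Fin (a (Fin.last d))} (hkl : k < l) {s : Fin c}
    (hk : HasColor (fun x => f (.snoc x k)) p s) (hl : HasColor (fun x => f (.snoc x l)) p s) :
    IsMonoBox f (.snoc p.1 k, .snoc p.2 l) := by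
  refine ⟨fun i => ?_, s, fun x hx => ?_⟩
  · refine Fin.lastCases ?_ (fun j => ?_) i
    · simpa using hkl
    · simpa using hp j
  · have hxs : x = GridPoint.snoc (fun i => x i.castSucc) (x (Fin.last d)) :=
      (Fin.snoc_init_self (α := fun i => Fin (a i)) x).symm
    have hinit : ∀ i : Fin d, x i.castSucc = p.1 i ∨ x i.castSucc = p.2 i := fun i => by
      simpa using hx i.castSucc
    have hlast : x (Fin.last d) = k ∨ x (Fin.last d) = l := by
      simpa using hx (Fin.last d)
    rw [hxs]
    rcases hlast with h | h <;> rw [h]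
    · exact hk _ hinit
    · exact hl _ hinit

lemma GridPoint.snoc_inj {d : ℕ} {a : Fin (d + 1) → ℕ}
    {x y : GridPoint d (fun i => a i.castSucc)} {k l : Fin (a (Fin.last d))}
    (h : GridPoint.snoc x k = GridPoint.snoc y l) : x = y ∧ k = l :=
  Fin.snoc_injective2 (α := fun i => Fin (a i)) h

/-- Discrete Jensen inequality for `n ↦ n (n - 1)`, in tangent-line form. -/
lemma mul_sub_one_le_sum {ι : Type*} (I : Finset ι) (n : ι → ℝ) {N y : ℝ}
    (hI : (I.card : ℝ) ≤ N) (hy : 1 ≤ y) (hn : N * y ≤ ∑ i ∈ I, n i) :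
    N * (y * (y - 1)) ≤ ∑ i ∈ I, n i * (n i - 1) := by
  have htangent : ∑ i ∈ I, ((2 * y - 1) * n i - y ^ 2) ≤ ∑ i ∈ I, n i * (n i - 1) :=
    sum_le_sum fun i _ => by nlinarith [sq_nonneg (n i - y)]
  rw [sum_sub_distrib, ← mul_sum, sum_const, nsmul_eq_mul] at htangent
  nlinarith [mul_le_mul_of_nonneg_left hn (show 0 ≤ 2 * y - 1 by linarith),
    mul_le_mul_of_nonneg_right hI (sq_nonneg y)]

open Classical in
/-- Bounding the monochromatic boxes of a coloring from those of its layers. -/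
lemma ncard_monoBoxSet_ge {d : ℕ} {a : Fin (d + 1) → ℕ} {c : ℕ}
    (f : GridPoint (d + 1) a → Fin c) {y : ℝ} (hy : 1 ≤ y)
    (hlayers : (∏ i : Fin d, ((a i.castSucc).choose 2 : ℝ)) * c * y ≤
      ∑ k : Fin (a (Fin.last d)),
        ((monoBoxSet fun x : GridPoint d (fun i => a i.castSucc) => f (.snoc x k)).ncard : ℝ)) :
    (∏ i : Fin d, ((a i.castSucc).choose 2 : ℝ)) * c * (y * (y - 1))
      ≤ 2 * ((monoBoxSet f).ncard : ℝ) := by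
  let G := GridPoint d (fun i => a i.castSucc)
  let B : Finset (G × G) := univ.filter fun p => ∀ i, p.1 i < p.2 i
  let S : (G × G) × Fin c → Finset (Fin (a (Fin.last d))) := fun q =>
    univ.filter fun k => HasColor (fun x => f (.snoc x k)) q.1 q.2
  have hI : (((B ×ˢ (univ : Finset (Fin c))).card : ℕ) : ℝ)
      ≤ (∏ i : Fin d, ((a i.castSucc).choose 2 : ℝ)) * c := by
    rw [card_product, card_univ, Fintype.card_fin]
    push_cast
    exact mul_le_mul_of_nonneg_right (card_boxes_le d _) (Nat.cast_nonneg c)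
  have hlayer_le : ∀ k : Fin (a (Fin.last d)),
      (monoBoxSet fun x : G => f (.snoc x k)).ncard ≤
        ((B ×ˢ (univ : Finset (Fin c))).filter fun q => k ∈ S q).card := by
    intro k
    have hsub : (monoBoxSet fun x : G => f (.snoc x k)) ⊆
        (((B ×ˢ (univ : Finset (Fin c))).filter fun q => k ∈ S q).image Prod.fst :
          Finset (G × G)) := by
      rintro p ⟨hp, s, hs⟩
      simp only [coe_image, Set.mem_image, mem_coe, mem_filter, mem_product, mem_univ, and_true,
        true_and, B, S]
      exact ⟨(p, s), ⟨hp, hs⟩, rfl⟩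
    calc _ ≤ _ := Set.ncard_le_ncard hsub (finite_toSet _)
      _ ≤ _ := by rw [Set.ncard_coe_finset]; exact card_image_le
  have hsum : ∑ k : Fin (a (Fin.last d)), (monoBoxSet fun x : G => f (.snoc x k)).ncard ≤
      ∑ q ∈ B ×ˢ (univ : Finset (Fin c)), (S q).card := by
    refine (sum_le_sum fun k _ => hlayer_le k).trans (le_of_eq ?_)
    have := sum_card_bipartiteAbove_eq_sum_card_bipartiteBelow (s := univ)
      (t := B ×ˢ (univ : Finset (Fin c))) fun k q => k ∈ S q
    simpa [bipartiteAbove, bipartiteBelow] using this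
  have hpairs : ∑ q ∈ B ×ˢ (univ : Finset (Fin c)),
      ((S q ×ˢ S q).filter fun r => r.1 < r.2).card ≤ (monoBoxSet f).ncard := by
    rw [← card_sigma, Set.ncard_eq_toFinset_card']
    refine card_le_card_of_injOn
      (fun r => (GridPoint.snoc r.1.1.1 r.2.1, GridPoint.snoc r.1.1.2 r.2.2)) ?_ ?_
    · rintro ⟨⟨p, s⟩, k, l⟩ h
      simp only [coe_sigma, Set.mem_sigma_iff, mem_coe, mem_filter, mem_product, mem_univ,
        and_true, true_and, B, S] at h
      exact Set.mem_toFinset.2 (IsMonoBox.snoc h.1 h.2.2 h.2.1.1 h.2.1.2)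
    · rintro ⟨⟨⟨p, p'⟩, s⟩, k, l⟩ h ⟨⟨⟨q, q'⟩, t⟩, m, n⟩ h' heq
      simp only [coe_sigma, Set.mem_sigma_iff, mem_coe, mem_filter, mem_product, mem_univ,
        and_true, true_and, B, S] at h h'
      obtain ⟨rfl, rfl⟩ := GridPoint.snoc_inj (Prod.ext_iff.1 heq).1
      obtain ⟨rfl, rfl⟩ := GridPoint.snoc_inj (Prod.ext_iff.1 heq).2
      obtain rfl := h.2.1.1.eq h'.2.1.1
      rfl
  have hjensen := mul_sub_one_le_sum (B ×ˢ (univ : Finset (Fin c))) (fun q => ((S q).card : ℝ))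
    hI hy (hlayers.trans (by exact_mod_cast hsum))
  refine hjensen.trans ?_
  simp only [← two_mul_card_filter_lt, ← mul_sum]
  have : (_ : ℝ) ≤ _ := Nat.cast_le.2 hpairs
  push_cast at this
  linarith

/-- with `Δ_0 = 1` and `Δ_j = Δ_{j-1}^2 (1 - (c^(2^(j-1))/Δ_{j-1} - 1)/(a_j - 1))`,
if `Δ_1, …, Δ_d > 0` then every `c`-coloring of `[a_1,…,a_d]` has at least
`M Δ_d / c^(2^d - 1)` monochromatic boxes.  (Here `a (j : Fin d)` is the paper's `a_{j+1}`.) -/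
theorem delta_box_bound (c d : ℕ) (hc : 1 ≤ c) (hd : 1 ≤ d)
    (a : Fin d → ℕ) (ha : ∀ i, 2 ≤ a i)
    (Δ : ℕ → ℝ) (h0 : Δ 0 = 1)
    (hrec : ∀ j : Fin d, Δ ((j : ℕ) + 1) =
      (Δ (j : ℕ)) ^ 2 * (1 - ((c : ℝ) ^ (2 ^ (j : ℕ)) / Δ (j : ℕ) - 1) / ((a j : ℝ) - 1)))
    (hpos : ∀ j : Fin d, 0 < Δ ((j : ℕ) + 1)) :
    ∀ f : GridPoint d a → Fin c,
      (∏ i, ((a i).choose 2 : ℝ)) * Δ d / (c : ℝ) ^ (2 ^ d - 1)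
        ≤ ((monoBoxSet f).ncard : ℝ) := by
  clear hd
  induction d with
  | zero =>
    intro f
    have hmem : ∀ p, p ∈ monoBoxSet f := fun p =>
      ⟨fun i => i.elim0, f p.1, fun x _ => congrArg f (funext fun i => i.elim0)⟩
    have hne : 0 < (monoBoxSet f).ncard :=
      (Set.ncard_pos (Set.toFinite _)).2 ⟨(fun i => i.elim0, fun i => i.elim0), hmem _⟩
    simpa [h0] using Nat.one_le_iff_ne_zero.2 hne.ne'
  | succ d ih =>
    intro f
    have hlayer := ih (fun i => a i.castSucc) (fun i => ha _) (fun j => hrec j.castSucc)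
      (fun j => hpos j.castSucc)
    have hΔ : 0 < Δ d := by
      cases d with
      | zero => simp [h0]
      | succ e => exact hpos (Fin.last e).castSucc
    have hstep := hrec (Fin.last d)
    have hnext := hpos (Fin.last d)
    have hcR : (0 : ℝ) < c := by exact_mod_cast hc
    have haR : (0 : ℝ) < (a (Fin.last d) : ℝ) - 1 := by
      have : (2 : ℝ) ≤ a (Fin.last d) := by exact_mod_cast ha _
      linarith
    simp only [Fin.val_last] at hstep hnext
    set A : ℝ := (a (Fin.last d) : ℝ)
    set C : ℝ := (c : ℝ) ^ 2 ^ d with hCdef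
    have hC : 0 < C := by positivity
    have hpow : (c : ℝ) ^ (2 ^ d - 1) = C / c := by
      rw [eq_div_iff hcR.ne', ← pow_succ, Nat.sub_add_cancel Nat.one_le_two_pow]
    have hpow' : (c : ℝ) ^ (2 ^ (d + 1) - 1) = C ^ 2 / c := by
      rw [eq_div_iff hcR.ne', ← pow_succ, Nat.sub_add_cancel Nat.one_le_two_pow, hCdef,
        ← pow_mul, pow_succ]
    have hfactor : (A - 1) * Δ (d + 1) = Δ d * (A * Δ d - C) := by
      rw [hstep]
      field_simp
      ring
    have hy : 1 ≤ A * Δ d / C := by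
      have h : 0 < Δ d * (A * Δ d - C) := hfactor ▸ mul_pos haR hnext
      rw [one_le_div hC]
      linarith [(mul_pos_iff_of_pos_left hΔ).1 h]
    have hmain := ncard_monoBoxSet_ge f hy (by
      refine le_trans (le_of_eq ?_) (sum_le_sum fun k _ => hlayer fun x => f (.snoc x k))
      rw [sum_const, card_univ, Fintype.card_fin, nsmul_eq_mul, hpow]
      field_simp
      rfl)
    refine le_of_mul_le_mul_left (le_trans (le_of_eq ?_) hmain) two_pos
    rw [Fin.prod_univ_castSucc, Nat.cast_choose_two, hpow']
    change 2 * (_ * (A * (A - 1) / 2) * _ / _) = _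
    field_simp
    linear_combination (∏ i : Fin d, ((a i.castSucc).choose 2 : ℝ)) * A * hfactor
end

section
/- Let c ≥ 1, d ≥ 1 be integers and a_1,…,a_d ≥ 2 be integers. If the grid R = [a_1,…,a_d] is not c-guaranteed (i.e., some c-coloring of R has no monochromatic box), then ε_c(R) := ∑_{i=1}^d 2^{d−i} · c^{2^{i−1}}/(a_i − 1) ≥ 1. -/
open Finset in
/-- The number of increasing pairs in a finite subset of a linear order. -/
theorem two_mul_card_filter_lt_s5 {α : Type*} [LinearOrder α] (L : Finset α) :
    (2 : ℝ) * #{p ∈ L ×ˢ L | p.1 < p.2} = #L * (#L - 1) := by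
  have hswap : #{p ∈ L ×ˢ L | p.2 < p.1} = #{p ∈ L ×ˢ L | p.1 < p.2} := by
    refine card_nbij' Prod.swap Prod.swap ?_ ?_ ?_ ?_ <;> intro p <;> simp <;> tauto
  have hunion : {p ∈ L ×ˢ L | p.1 < p.2} ∪ {p ∈ L ×ˢ L | p.2 < p.1} = L.offDiag := by
    ext p
    simp only [mem_union, mem_filter, mem_product, mem_offDiag, ne_iff_lt_or_gt]
    tauto
  have hdisj : Disjoint {p ∈ L ×ˢ L | p.1 < p.2} {p ∈ L ×ˢ L | p.2 < p.1} :=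
    disjoint_filter.2 fun p _ h h' => lt_asymm h h'
  have hcard := card_union_of_disjoint hdisj
  rw [hunion, hswap, offDiag_card] at hcard
  have h : #L * #L = 2 * #{p ∈ L ×ˢ L | p.1 < p.2} + #L := by
    have := Nat.le_mul_self #L
    omega
  have h' : (#L : ℝ) * #L = 2 * #{p ∈ L ×ˢ L | p.1 < p.2} + #L := by exact_mod_cast h
  linarith

open Finset in
/-- The coloured boxes of the grid `a`: pairs consisting of a box, given by its pairs of
coordinates in increasing order, and a colour. -/
def colouredBoxes (d : ℕ) (a : Fin d → ℕ) (c : ℕ) :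
    Finset (((i : Fin d) → Fin (a i) × Fin (a i)) × Fin c) :=
  Fintype.piFinset (fun _ => {p | p.1 < p.2}) ×ˢ univ

open Finset Classical in
/-- The coloured boxes on which the colouring `f` takes the given colour. -/
noncomputable def monoColouredBoxes {d : ℕ} {a : Fin d → ℕ} {c : ℕ}
    (f : GridPoint d a → Fin c) :
    Finset (((i : Fin d) → Fin (a i) × Fin (a i)) × Fin c) :=
  {q ∈ colouredBoxes d a c |
    ∀ x : GridPoint d a, (∀ i, x i = (q.1 i).1 ∨ x i = (q.1 i).2) → f x = q.2}

open Finset in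
theorem card_colouredBoxes (d : ℕ) (a : Fin d → ℕ) (c : ℕ) :
    (#(colouredBoxes d a c) : ℝ) = (∏ i, (a i : ℝ) * (a i - 1) / 2) * c := by
  have h (n : ℕ) : (#{p : Fin n × Fin n | p.1 < p.2} : ℝ) = n * (n - 1) / 2 := by
    have := two_mul_card_filter_lt_s5 (univ : Finset (Fin n))
    rw [univ_product_univ, card_fin] at this
    linarith
  simp [colouredBoxes, card_product, Fintype.card_piFinset, h]

/-- The layer of a colouring of a `(d + 1)`-dimensional grid at last coordinate `j`. -/
def gridLayer {d : ℕ} {a : Fin (d + 1) → ℕ} {c : ℕ} (f : GridPoint (d + 1) a → Fin c)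
    (j : Fin (a (Fin.last d))) : GridPoint d (fun i => a i.castSucc) → Fin c :=
  fun x => f (Fin.snoc (α := fun i => Fin (a i)) x j)

open Finset Classical in
/-- The layers of `f` in which a coloured box is monochromatic. -/
noncomputable def monoLayers {d : ℕ} {a : Fin (d + 1) → ℕ} {c : ℕ}
    (f : GridPoint (d + 1) a → Fin c)
    (q : ((i : Fin d) → Fin (a i.castSucc) × Fin (a i.castSucc)) × Fin c) :
    Finset (Fin (a (Fin.last d))) :=
  {j | q ∈ monoColouredBoxes (gridLayer f j)}

open Finset in
theorem sum_card_monoLayers {d : ℕ} {a : Fin (d + 1) → ℕ} {c : ℕ}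
    (f : GridPoint (d + 1) a → Fin c) :
    ∑ q ∈ colouredBoxes d (fun i => a i.castSucc) c, #(monoLayers f q) =
      ∑ j, #(monoColouredBoxes (gridLayer f j)) := by
  classical
  refine (sum_card_bipartiteAbove_eq_sum_card_bipartiteBelow
    (fun q j => q ∈ monoColouredBoxes (gridLayer f j))
    (s := colouredBoxes d (fun i => a i.castSucc) c) (t := univ)).trans ?_
  refine sum_congr rfl fun j _ => ?_
  congr 1
  ext q
  simp only [bipartiteBelow, mem_filter, and_iff_right_iff_imp]
  exact fun h => (mem_filter.1 h).1

open Finset in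
/-- A coloured box that is monochromatic in two layers yields a monochromatic box one
dimension up. -/
theorem sum_card_pairs_le_card_monoColouredBoxes {d : ℕ} {a : Fin (d + 1) → ℕ} {c : ℕ}
    (f : GridPoint (d + 1) a → Fin c) :
    ∑ q ∈ colouredBoxes d (fun i => a i.castSucc) c,
        #{p ∈ monoLayers f q ×ˢ monoLayers f q | p.1 < p.2} ≤ #(monoColouredBoxes f) := by
  classical
  rw [← card_sigma]
  refine card_le_card_of_injOn
    (fun z => (Fin.snoc (α := fun i => Fin (a i) × Fin (a i)) z.1.1 z.2, z.1.2)) ?_ ?_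
  · rintro ⟨⟨b, s⟩, j, k⟩ hz
    simp only [coe_sigma, Set.mem_sigma_iff, mem_coe, mem_filter, mem_product, monoLayers,
      mem_univ, true_and, monoColouredBoxes, colouredBoxes, Fintype.mem_piFinset, and_true,
      gridLayer] at hz ⊢
    obtain ⟨hb, ⟨⟨-, hj⟩, -, hk⟩, hjk⟩ := hz
    refine ⟨fun i => ?_, fun x hx => ?_⟩
    · induction i using Fin.lastCases with
      | last => simpa using hjk
      | cast i => simpa using hb i
    · have hinit (i : Fin d) : x i.castSucc = (b i).1 ∨ x i.castSucc = (b i).2 := by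
        simpa using hx i.castSucc
      have hlast : x (Fin.last d) = j ∨ x (Fin.last d) = k := by
        simpa using hx (Fin.last d)
      have hsnoc : Fin.snoc (α := fun i => Fin (a i)) (fun i => x i.castSucc)
          (x (Fin.last d)) = x := Fin.snoc_init_self x
      rw [← hsnoc]
      rcases hlast with h | h <;> rw [h]
      exacts [hj _ hinit, hk _ hinit]
  · rintro ⟨⟨b, s⟩, p⟩ - ⟨⟨b', s'⟩, p'⟩ - h
    obtain ⟨h₁, rfl⟩ := Prod.mk.inj h
    obtain ⟨rfl, rfl⟩ := Fin.snoc_injective2 (α := fun i => Fin (a i) × Fin (a i)) h₁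
    rfl

open Finset in
/-- The convexity estimate behind the induction on the dimension. -/
theorem sum_mul_sub_one_ge {ι : Type*} (P : Finset ι) (n : ι → ℝ) {K A e : ℝ}
    (hK : 0 < K) (hA : 1 < A) (he : 0 ≤ e)
    (hn : A * ((1 - e) * #P) ≤ K * ∑ q ∈ P, n q) (hn0 : 0 ≤ ∑ q ∈ P, n q * (n q - 1)) :
    (1 - (2 * e + K / (A - 1))) * (#P * (A * (A - 1))) ≤
      K ^ 2 * ∑ q ∈ P, n q * (n q - 1) := by
  have hA' : 0 < A - 1 := by linarith
  have hW : (0 : ℝ) ≤ #P := by positivity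
  rcases le_or_gt 1 (2 * e + K / (A - 1)) with h | h
  · refine le_trans (mul_nonpos_of_nonpos_of_nonneg (by linarith) (by positivity)) ?_
    positivity
  have hKA : K < (1 - 2 * e) * (A - 1) := by
    rw [← div_lt_iff₀ hA']
    linarith
  have he' : 0 < 1 - 2 * e := pos_of_mul_pos_left (hK.trans hKA) hA'.le
  have hsum : (2 * (A * (1 - e)) - K) * (K * ∑ q ∈ P, n q) - #P * (A * (1 - e)) ^ 2 ≤
      K ^ 2 * ∑ q ∈ P, n q * (n q - 1) := by
    calc _ = ∑ q ∈ P, ((2 * (A * (1 - e)) - K) * (K * n q) - (A * (1 - e)) ^ 2) := by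
          rw [sum_sub_distrib, ← mul_sum, ← mul_sum, sum_const, nsmul_eq_mul]
      _ ≤ ∑ q ∈ P, K ^ 2 * (n q * (n q - 1)) :=
          sum_le_sum fun q _ => by nlinarith [sq_nonneg (K * n q - A * (1 - e))]
      _ = _ := by rw [mul_sum]
  have hm : 0 ≤ 2 * (A * (1 - e)) - K := by nlinarith
  have hmul := mul_le_mul_of_nonneg_left hn hm
  have hexp : (1 - (2 * e + K / (A - 1))) * (#P * (A * (A - 1))) =
      #P * (A * ((1 - 2 * e) * (A - 1) - K)) := by
    field_simp
    ring
  have hkey : A * ((1 - 2 * e) * (A - 1) - K) ≤ A * ((1 - e) * (A * (1 - e) - K)) := by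
    refine mul_le_mul_of_nonneg_left ?_ (by linarith)
    nlinarith [mul_nonneg (zero_lt_one.trans hA).le (sq_nonneg e), mul_nonneg hK.le he]
  have := mul_le_mul_of_nonneg_left hkey hW
  rw [hexp]
  linarith

open Finset in
/-- A quantitative form of the bound: every colouring has many monochromatic boxes. -/
theorem card_monoColouredBoxes_ge {c : ℕ} (hc : 1 ≤ c) (d : ℕ) (a : Fin d → ℕ)
    (ha : ∀ i, 2 ≤ a i) (f : GridPoint d a → Fin c) :
    (1 - ∑ i : Fin d, (2 : ℝ) ^ (d - 1 - (i : ℕ)) * (c : ℝ) ^ (2 ^ (i : ℕ)) / ((a i : ℝ) - 1)) *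
      #(colouredBoxes d a c) ≤ (c : ℝ) ^ (2 ^ d) * #(monoColouredBoxes f) := by
  have hc' : (0 : ℝ) < c := by exact_mod_cast hc
  induction d with
  | zero =>
    classical
    have h : (1 : ℝ) ≤ #(monoColouredBoxes f) := by
      rw [Nat.one_le_cast, Nat.one_le_iff_ne_zero, ← Nat.pos_iff_ne_zero, card_pos]
      refine ⟨(fun i => i.elim0, f fun i => i.elim0), mem_filter.2 ⟨?_, fun x _ => ?_⟩⟩
      · simp [colouredBoxes, eq_iff_true_of_subsingleton]
      · exact congrArg f (funext fun i => i.elim0)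
    simpa [card_colouredBoxes] using le_mul_of_one_le_right hc'.le h
  | succ d ih =>
    set b : Fin d → ℕ := fun i => a i.castSucc with hb
    set A : ℝ := (a (Fin.last d) : ℝ) with hAdef
    set e : ℝ := ∑ i : Fin d, (2 : ℝ) ^ (d - 1 - (i : ℕ)) * (c : ℝ) ^ (2 ^ (i : ℕ)) /
      ((b i : ℝ) - 1) with hedef
    have hge (i) : (2 : ℝ) ≤ a i := by exact_mod_cast ha i
    have hA : 1 < A := by linarith [hge (Fin.last d)]
    have he : 0 ≤ e := sum_nonneg fun i _ => by
      have : (0 : ℝ) ≤ (b i : ℝ) - 1 := by linarith [hge i.castSucc]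
      positivity
    have heps : ∑ i : Fin (d + 1), (2 : ℝ) ^ (d + 1 - 1 - (i : ℕ)) * (c : ℝ) ^ (2 ^ (i : ℕ)) /
        ((a i : ℝ) - 1) = 2 * e + (c : ℝ) ^ (2 ^ d) / (A - 1) := by
      rw [Fin.sum_univ_castSucc, hedef, mul_sum]
      congr 1
      · refine sum_congr rfl fun i _ => ?_
        have : d + 1 - 1 - (i.castSucc : ℕ) = (d - 1 - i) + 1 := by
          have := i.isLt
          simp only [Fin.val_castSucc]
          omega
        rw [this, pow_succ, Fin.val_castSucc]
        ring
      · simp [hAdef]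
    have hcard : (#(colouredBoxes (d + 1) a c) : ℝ) =
        #(colouredBoxes d b c) * (A * (A - 1)) / 2 := by
      rw [card_colouredBoxes, card_colouredBoxes, Fin.prod_univ_castSucc]
      ring
    have hpairs : ∑ q ∈ colouredBoxes d b c,
        (#(monoLayers f q) : ℝ) * (#(monoLayers f q) - 1) ≤ 2 * #(monoColouredBoxes f) := by
      simp_rw [← two_mul_card_filter_lt_s5, ← mul_sum]
      gcongr
      exact_mod_cast sum_card_pairs_le_card_monoColouredBoxes f
    have hlayers : A * ((1 - e) * #(colouredBoxes d b c)) ≤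
        (c : ℝ) ^ (2 ^ d) * ∑ q ∈ colouredBoxes d b c, (#(monoLayers f q) : ℝ) := by
      have hswap : ∑ q ∈ colouredBoxes d b c, (#(monoLayers f q) : ℝ) =
          ∑ j, (#(monoColouredBoxes (gridLayer f j)) : ℝ) := by
        exact_mod_cast sum_card_monoLayers f
      rw [hswap, mul_sum]
      have := sum_le_sum fun j (_ : j ∈ (univ : Finset (Fin (a (Fin.last d))))) =>
        ih b (fun i => ha i.castSucc) (gridLayer f j)
      simpa using this
    have hnonneg : 0 ≤ ∑ q ∈ colouredBoxes d b c,
        (#(monoLayers f q) : ℝ) * (#(monoLayers f q) - 1) :=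
      sum_nonneg fun q _ => by
        rw [← two_mul_card_filter_lt_s5]
        positivity
    have hstep := sum_mul_sub_one_ge (colouredBoxes d b c) (fun q => (#(monoLayers f q) : ℝ))
      (pow_pos hc' (2 ^ d)) hA he hlayers hnonneg
    have hbound := mul_le_mul_of_nonneg_left hpairs (pow_pos (pow_pos hc' (2 ^ d)) 2).le
    rw [heps, hcard, pow_succ 2 d, pow_mul]
    linarith

/-- if `[a_1,…,a_d]` is not `c`-guaranteed then
`ε_c(R) = ∑_{i=1}^d 2^(d-i) c^(2^(i-1)) / (a_i - 1) ≥ 1`.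
(Here `i : Fin d` corresponds to the paper's index `i+1`.) -/
theorem eps_lower_bound (c d : ℕ) (hc : 1 ≤ c) (hd : 1 ≤ d)
    (a : Fin d → ℕ) (ha : ∀ i, 2 ≤ a i)
    (h : ¬ Guaranteed d a c 1) :
    1 ≤ ∑ i : Fin d, (2 : ℝ) ^ (d - 1 - (i : ℕ)) * (c : ℝ) ^ (2 ^ (i : ℕ)) / ((a i : ℝ) - 1) := by
  by_contra! hlt
  refine h fun f => ?_
  have hc' : (0 : ℝ) < c := by exact_mod_cast hc
  have hpos : (0 : ℝ) < (colouredBoxes d a c).card := by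
    rw [card_colouredBoxes]
    refine mul_pos (Finset.prod_pos fun i _ => ?_) hc'
    have : (2 : ℝ) ≤ a i := by exact_mod_cast ha i
    have : (0 : ℝ) < (a i : ℝ) - 1 := by linarith
    positivity
  have hmono := (mul_pos (sub_pos.2 hlt) hpos).trans_le (card_monoColouredBoxes_ge hc d a ha f)
  have hcard : 0 < (monoColouredBoxes f).card := by
    exact_mod_cast pos_of_mul_pos_right hmono (pow_pos hc' _).le
  obtain ⟨⟨b, s⟩, hb⟩ := Finset.card_pos.1 hcard
  simp only [monoColouredBoxes, colouredBoxes, Finset.mem_filter, Finset.mem_product,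
    Fintype.mem_piFinset, Finset.mem_univ, true_and, and_true] at hb
  have : Finite (GridPoint d a) := inferInstanceAs (Finite ((i : Fin d) → Fin (a i)))
  exact (Set.ncard_pos (Set.toFinite _)).2
    ⟨(fun i => (b i).1, fun i => (b i).2), hb.1, s, hb.2⟩
end

section
/- For all integers d ≥ 1 and c ≥ 2, there exists an integer n < (d+2)·c^{2^{d−1}} such that the equilateral grid [n]^d = [n,…,n] (d copies) is c-guaranteed; in particular, the least n such that [n]^d is c-guaranteed satisfies n < (d+2)·c^{2^{d−1}}. -/
/-- If the sets `A z ⊆ Fin n` have average size at least `x > 1`, then some two distinct indices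
lie together in `A z` for a proportion at least `x (x - 1) / n ^ 2` of all `z`. -/
lemma exists_lt_card_common_ge {Z : Type*} [Fintype Z] [Nonempty Z] {n : ℕ} (hn : 0 < n)
    (A : Z → Finset (Fin n)) {x : ℝ} (hx : 1 < x)
    (hA : x * Fintype.card Z ≤ ∑ z, ((A z).card : ℝ)) :
    ∃ y y' : Fin n, y < y' ∧ x * (x - 1) * Fintype.card Z ≤
      (n : ℝ) ^ 2 * (Finset.univ.filter fun z => y ∈ A z ∧ y' ∈ A z).card := by
  have hZ : (0 : ℝ) < Fintype.card Z := by exact_mod_cast Fintype.card_pos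
  have hn' : (0 : ℝ) < n := by exact_mod_cast hn
  by_contra! h
  have hne : ∀ p ∈ (Finset.univ : Finset (Fin n)).offDiag,
      (n : ℝ) ^ 2 * (Finset.univ.filter fun z => p.1 ∈ A z ∧ p.2 ∈ A z).card ≤
        x * (x - 1) * Fintype.card Z := by
    rintro ⟨y, y'⟩ hp
    rcases lt_or_gt_of_ne (Finset.mem_offDiag.1 hp).2.2 with hlt | hlt
    · exact (h y y' hlt).le
    · simpa only [and_comm] using (h y' y hlt).le
  have hcount : ∑ z, (A z).offDiag.card =
      ∑ p ∈ (Finset.univ : Finset (Fin n)).offDiag,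
        (Finset.univ.filter fun z => p.1 ∈ A z ∧ p.2 ∈ A z).card := by
    have := Finset.sum_card_bipartiteAbove_eq_sum_card_bipartiteBelow
      (s := (Finset.univ : Finset Z)) (t := (Finset.univ : Finset (Fin n)).offDiag)
      (fun z p => p.1 ∈ A z ∧ p.2 ∈ A z)
    refine Eq.trans (Finset.sum_congr rfl fun z _ => congrArg Finset.card ?_) this
    ext p
    simp only [Finset.mem_offDiag, Finset.bipartiteAbove, Finset.mem_filter, Finset.mem_univ,
      true_and]
    tauto
  have hlower : x * (x - 1) * Fintype.card Z ≤ ∑ z, ((A z).offDiag.card : ℝ) := by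
    have hpt : ∀ z ∈ (Finset.univ : Finset Z),
        (2 * x - 1) * (A z).card - x ^ 2 ≤ ((A z).offDiag.card : ℝ) := by
      intro z _
      rw [Finset.offDiag_card, Nat.cast_sub (Nat.le_mul_self _), Nat.cast_mul]
      nlinarith [sq_nonneg (((A z).card : ℝ) - x)]
    have hsum := Finset.sum_le_sum hpt
    rw [Finset.sum_sub_distrib, ← Finset.mul_sum, Finset.sum_const, Finset.card_univ,
      nsmul_eq_mul] at hsum
    nlinarith
  have hupper := Finset.sum_le_card_nsmul _ _ _ hne
  rw [← Finset.mul_sum, ← Nat.cast_sum, ← hcount, Finset.offDiag_card, nsmul_eq_mul,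
    Nat.cast_sub (Nat.le_mul_self _), Finset.card_univ, Fintype.card_fin, Nat.cast_mul,
    Nat.cast_sum] at hupper
  have hM : 0 < x * (x - 1) * Fintype.card Z := by
    have : 0 < x - 1 := by linarith
    positivity
  nlinarith [mul_le_mul_of_nonneg_left hlower (sq_nonneg (n : ℝ)), mul_pos hn' hM]

/-- A sufficiently dense subset of an equilateral grid contains all the points of a box. -/
lemma exists_box_subset_of_dense {n : ℕ} (e : ℕ) {C α : ℝ} (hα : 0 ≤ α) (hα' : α ≤ 1 / 2)
    (hC : 2 * (1 + 2 * α) ≤ C) (hn : 3 * C ^ 2 ^ e < 2 * n)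
    (S : Finset (Fin (e + 1) → Fin n)) (hS : (n / C - α) * n ^ e ≤ S.card) :
    ∃ p q : Fin (e + 1) → Fin n, (∀ i, p i < q i) ∧
      ∀ x : Fin (e + 1) → Fin n, (∀ i, x i = p i ∨ x i = q i) → x ∈ S := by
  have hC2 : 2 ≤ C := by linarith
  have hC0 : 0 < C := by linarith
  have hx : 1 < n / C - α := by
    have h1 : C ≤ C ^ 2 ^ e := le_self_pow₀ (by linarith) (by positivity)
    have : 3 / 2 < n / C := by
      rw [lt_div_iff₀ hC0]
      linarith
    linarith
  induction e generalizing C α with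
  | zero =>
    have hcard : 1 < S.card := by
      have : (1 : ℝ) < S.card := hx.trans_le (by rwa [pow_zero, mul_one] at hS)
      exact_mod_cast this
    obtain ⟨a, ha, b, hb, hab⟩ := Finset.one_lt_card.1 hcard
    have key : ∀ a ∈ S, ∀ b ∈ S, a 0 < b 0 → ∃ p q : Fin (0 + 1) → Fin n, (∀ i, p i < q i) ∧
        ∀ x : Fin (0 + 1) → Fin n, (∀ i, x i = p i ∨ x i = q i) → x ∈ S := by
      intro a ha b hb hlt
      refine ⟨a, b, fun i => by rwa [Fin.fin_one_eq_zero i], fun x h => ?_⟩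
      rcases h 0 with h | h
      · rwa [show x = a from funext fun i => by rwa [Fin.fin_one_eq_zero i]]
      · rwa [show x = b from funext fun i => by rwa [Fin.fin_one_eq_zero i]]
    have hne : a 0 ≠ b 0 := fun h => hab (funext fun i => by rwa [Fin.fin_one_eq_zero i])
    rcases lt_or_gt_of_ne hne with h | h
    · exact key a ha b hb h
    · exact key b hb a ha h
  | succ e ih =>
    have hn0 : (0 : ℝ) < n := by
      have : 0 < C ^ 2 ^ (e + 1) := by positivity
      linarith
    have hn0' : 0 < n := by exact_mod_cast hn0
    have : Nonempty (Fin (e + 1) → Fin n) := ⟨fun _ => ⟨0, hn0'⟩⟩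
    have hsum : ∑ z : Fin (e + 1) → Fin n,
        (Finset.univ.filter fun y : Fin n => (Fin.cons y z : Fin (e + 2) → Fin n) ∈ S).card
        = S.card := by
      simp only [Finset.card_filter]
      rw [← Fintype.sum_prod_type_right'
        (fun (y : Fin n) (z : Fin (e + 1) → Fin n) =>
          if (Fin.cons y z : Fin (e + 2) → Fin n) ∈ S then 1 else 0),
        Fintype.sum_equiv (Fin.consEquiv fun _ : Fin (e + 2) => Fin n)
          (fun w => if (Fin.cons w.1 w.2 : Fin (e + 2) → Fin n) ∈ S then 1 else 0)
          (fun w => if w ∈ S then 1 else 0) (fun _ => rfl)]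
      simp
    obtain ⟨y, y', hlt, hT⟩ := exists_lt_card_common_ge hn0'
      (fun z : Fin (e + 1) → Fin n =>
        Finset.univ.filter fun y : Fin n => (Fin.cons y z : Fin (e + 2) → Fin n) ∈ S) hx
      (by rw [← Nat.cast_sum, hsum]; simpa using hS)
    simp only [Finset.mem_filter, Finset.mem_univ, true_and, Fintype.card_pi_const,
      Fintype.card_fin, Nat.cast_pow] at hT
    have hC4 : 4 ≤ C ^ 2 := by nlinarith
    have hx' : (n : ℝ) * (n / C ^ 2 - 1 / 2) ≤ (n / C - α) * (n / C - α - 1) := by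
      have h1 : (n : ℝ) / C * (1 + 2 * α) ≤ n / 2 := by
        rw [div_mul_eq_mul_div, div_le_iff₀ hC0]
        nlinarith
      have h2 : (n : ℝ) * (n / C ^ 2) = (n / C) ^ 2 := by ring
      nlinarith [mul_nonneg hα hα]
    have hn2 : 3 * (C ^ 2) ^ 2 ^ e < 2 * n := by
      rwa [← pow_mul, ← pow_succ']
    obtain ⟨p, q, hpq, hbox⟩ := ih (C := C ^ 2) (α := 1 / 2) (by norm_num) le_rfl (by linarith)
      hn2
      (Finset.univ.filter fun z => (Fin.cons y z : Fin (e + 2) → Fin n) ∈ S ∧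
        (Fin.cons y' z : Fin (e + 2) → Fin n) ∈ S)
      (by
        refine le_of_mul_le_mul_left (le_trans ?_ hT) (by positivity : (0 : ℝ) < (n : ℝ) ^ 2)
        calc (n : ℝ) ^ 2 * ((n / C ^ 2 - 1 / 2) * n ^ e)
            = n * (n / C ^ 2 - 1 / 2) * n ^ (e + 1) := by ring
          _ ≤ _ := by gcongr)
      (by linarith) (by positivity)
      (by
        have h1 : C ^ 2 ≤ (C ^ 2) ^ 2 ^ e := le_self_pow₀ (by linarith) (by positivity)
        have : 3 / 2 < n / C ^ 2 := by
          rw [lt_div_iff₀ (by positivity)]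
          linarith
        linarith)
    refine ⟨Fin.cons y p, Fin.cons y' q, fun i => ?_, fun x h => ?_⟩
    · refine Fin.cases ?_ (fun j => ?_) i
      · simpa using hlt
      · simpa using hpq j
    · have htail := (Finset.mem_filter.1 (hbox (Fin.tail x) fun j => by
        simpa [Fin.tail] using h j.succ)).2
      rw [← Fin.cons_self_tail x]
      rcases h 0 with h0 | h0
      · rw [h0]
        exact htail.1
      · rw [h0]
        exact htail.2

/-- for `d ≥ 1` and `c ≥ 2` there is `n < (d+2) c^(2^(d-1))` with the
equilateral grid `[n]^d` `c`-guaranteed (hence the least such `n` satisfies this bound). -/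
theorem equilateral_bound (d c : ℕ) (hd : 1 ≤ d) (hc : 2 ≤ c) :
    ∃ n : ℕ, n < (d + 2) * c ^ (2 ^ (d - 1)) ∧ Guaranteed d (fun _ => n) c 1 := by
  obtain ⟨e, rfl⟩ := Nat.exists_eq_add_of_le' hd
  rw [Nat.add_sub_cancel]
  have hpow : 0 < c ^ 2 ^ e := by positivity
  obtain ⟨n, hn⟩ : ∃ n, n = 2 * c ^ 2 ^ e := ⟨_, rfl⟩
  refine ⟨n, hn ▸ Nat.mul_lt_mul_of_pos_right (by omega) hpow, fun f => ?_⟩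
  have hc' : (2 : ℝ) ≤ c := by exact_mod_cast hc
  have : Nonempty (Fin c) := ⟨⟨0, by omega⟩⟩
  let g : (Fin (e + 1) → Fin n) → Fin c := f
  obtain ⟨s, hs⟩ := Fintype.exists_le_card_fiber_of_nsmul_le_card
    (M := ℝ) g (b := (n : ℝ) / c * n ^ e) (by
      rw [nsmul_eq_mul, Fintype.card_fin, Fintype.card_pi_const, Fintype.card_fin]
      push_cast
      apply le_of_eq
      field_simp
      ring)
  obtain ⟨p, q, hpq, hbox⟩ := exists_box_subset_of_dense (n := n) e (C := c) (α := 0) le_rfl (by norm_num)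
    (by linarith) (by
      have : (0 : ℝ) < (c : ℝ) ^ 2 ^ e := by positivity
      rw [hn]
      push_cast
      linarith) _ (by simpa using hs)
  have : Finite (GridPoint (e + 1) fun _ => n) :=
    inferInstanceAs (Finite (Fin (e + 1) → Fin n))
  refine (Set.ncard_pos (Set.toFinite _)).2 ⟨(p, q), hpq, s, fun x h => ?_⟩
  exact (Finset.mem_filter.1 (hbox x h)).2
end

section
/- For all integers d ≥ 1 and c ≥ 2, the quantity V(c,d) satisfies 2^{−d}·e^{−1} < V(c,d)/c^{2^d−1} < (d+2)^d · 2^{d(d−1)/2}, where e is Euler's number. -/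
open Finset in
/-- If `R` is disjoint from `e \ {w}`, then prescribing a constant value on `e` divides the number
of colorings satisfying a property that depends only on `R` by at least `c ^ (#e - 1)`. -/
theorem card_const_mul_pow_le {α : Type*} [Fintype α] [DecidableEq α] {c : ℕ} (e R : Finset α)
    (w : α) (hw : w ∈ e) (hR : Disjoint R (e.erase w)) (P : (α → Fin c) → Prop)
    [DecidablePred P] (hP : ∀ f g : α → Fin c, (∀ x ∈ R, f x = g x) → P f → P g)
    (B : Finset (α → Fin c)) (hB : ∀ f ∈ B, P f ∧ ∃ s, ∀ x ∈ e, f x = s) :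
    #B * c ^ (#e - 1) ≤ #{f : α → Fin c | P f} := by
  have key : #(B ×ˢ (univ : Finset (↥(e.erase w) → Fin c))) ≤
      #{f : α → Fin c | P f} := by
    refine card_le_card_of_injOn
      (fun z x => if h : x ∈ e.erase w then z.2 ⟨x, h⟩ else z.1 x) ?_ ?_
    · rintro ⟨f, g⟩ hz
      simp only [coe_product, Set.mem_prod, mem_coe] at hz
      simp only [mem_coe, mem_filter, mem_univ, true_and]
      refine hP f _ (fun x hx => ?_) (hB f hz.1).1
      rw [dif_neg (disjoint_left.1 hR hx)]
    · rintro ⟨f, g⟩ hz ⟨f', g'⟩ hz' h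
      simp only [coe_product, Set.mem_prod, mem_coe] at hz hz'
      have h' : ∀ x, (if h : x ∈ e.erase w then g ⟨x, h⟩ else f x) =
          if h : x ∈ e.erase w then g' ⟨x, h⟩ else f' x := fun x => congrFun h x
      obtain ⟨s, hs⟩ := (hB f hz.1).2
      obtain ⟨s', hs'⟩ := (hB f' hz'.1).2
      have hww : f w = f' w := by simpa using h' w
      refine Prod.ext (funext fun x => ?_) (funext fun x => ?_)
      · by_cases hx : x ∈ e
        · change f x = f' x
          rw [hs x hx, hs' x hx, ← hs w hw, ← hs' w hw, hww]
        · simpa [hx] using h' x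
      · simpa [x.2] using h' x
  rwa [card_product, card_univ, Fintype.card_fun, Fintype.card_coe, Fintype.card_fin,
    card_erase_of_mem hw] at key

/-- No edge of the hypergraph `e` contained in `S` is monochromatic for `f`. -/
def ProperOn {α ι β : Type*} (e : ι → Finset α) (S : Finset α) (f : α → β) : Prop :=
  ∀ i, e i ⊆ S → ¬ ∃ s, ∀ x ∈ e i, f x = s

theorem ProperOn.mono {α ι β : Type*} {e : ι → Finset α} {S T : Finset α} {f : α → β}
    (h : ProperOn e S f) (hT : T ⊆ S) : ProperOn e T f :=
  fun i hi => h i (hi.trans hT)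

theorem ProperOn.congr {α ι β : Type*} {e : ι → Finset α} {S : Finset α} {f g : α → β}
    (hfg : ∀ x ∈ S, f x = g x) (h : ProperOn e S f) : ProperOn e S g := by
  rintro i hi ⟨s, hs⟩
  exact h i hi ⟨s, fun x hx => by rw [hfg x (hi hx), hs x hx]⟩

open Finset Classical in
/-- One step of the counting argument for proper colorings of uniform hypergraphs: adding a vertex
multiplies the number of proper colorings by at least `r * c`. -/
theorem card_properOn_insert {α ι : Type*} [Fintype α] [Fintype ι] {c k : ℕ} {D r : ℝ}
    (hc : 1 ≤ c) (hk : 2 ≤ k) (hr : 0 < r) (e : ι → Finset α) (he : ∀ i, #(e i) = k)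
    (hdeg : ∀ v, (#{i | v ∈ e i} : ℝ) ≤ D)
    (hD : D ≤ (1 - r) * (c ^ (k - 1) * r ^ (k - 2)))
    (S : Finset α) (v : α) (hv : v ∉ S)
    (hS : ∀ T ⊆ S, r ^ #T * #{f : α → Fin c | ProperOn e (S \ T) f} ≤
      #{f : α → Fin c | ProperOn e S f}) :
    r * #{f : α → Fin c | ProperOn e S f} ≤ #{f : α → Fin c | ProperOn e (insert v S) f} := by
  set N : ℝ := (#{f : α → Fin c | ProperOn e S f} : ℝ) with hN
  have hN0 : 0 ≤ N := Nat.cast_nonneg _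
  have hK : (0 : ℝ) < c ^ (k - 1) * r ^ (k - 2) := by
    have : (0 : ℝ) < c := by exact_mod_cast hc
    positivity
  set I : Finset ι := {i | v ∈ e i ∧ e i ⊆ insert v S} with hI
  set B : ι → Finset (α → Fin c) := fun i =>
    {f | ProperOn e S f ∧ ∃ s, ∀ x ∈ e i, f x = s} with hBdef
  have hcover : ({f : α → Fin c | ProperOn e S f} : Finset _) ⊆
      ({f : α → Fin c | ProperOn e (insert v S) f} : Finset _) ∪ I.biUnion B := by
    intro f hf
    simp only [mem_filter, mem_univ, true_and] at hf
    rw [mem_union, or_iff_not_imp_left]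
    intro hnot
    simp only [mem_filter, mem_univ, true_and] at hnot
    unfold ProperOn at hnot
    push Not at hnot
    obtain ⟨i, hi, s, hs⟩ := hnot
    have hvi : v ∈ e i := by
      by_contra hvi
      exact hf i ((subset_insert_iff_of_notMem hvi).1 hi) ⟨s, hs⟩
    simp only [mem_biUnion, hI, hBdef, mem_filter, mem_univ, true_and]
    exact ⟨i, ⟨hvi, hi⟩, hf, s, hs⟩
  have hbad : ∀ i ∈ I, (#(B i) : ℝ) ≤ N / (c ^ (k - 1) * r ^ (k - 2)) := by
    intro i hi
    simp only [hI, mem_filter, mem_univ, true_and] at hi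
    obtain ⟨hvi, hiS⟩ := hi
    obtain ⟨w, hw, hwv⟩ := exists_mem_ne (by rw [he i]; omega : 1 < #(e i)) v
    have hTS : ((e i).erase v).erase w ⊆ S :=
      (erase_subset _ _).trans (subset_insert_iff.1 hiS)
    have hTcard : #(((e i).erase v).erase w) = k - 2 := by
      rw [card_erase_of_mem (mem_erase.2 ⟨hwv, hw⟩), card_erase_of_mem hvi, he i]
      omega
    have h1 := card_const_mul_pow_le (c := c) (e i) (S \ ((e i).erase v).erase w) w hw
      (by
        rw [disjoint_left]
        intro x hx hx'
        simp only [mem_sdiff, mem_erase] at hx hx'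
        refine hx.2 ⟨hx'.1, ?_, hx'.2⟩
        rintro rfl
        exact hv hx.1)
      (ProperOn e (S \ ((e i).erase v).erase w)) (fun f g => ProperOn.congr) (B i)
      (fun f hf => by
        simp only [hBdef, mem_filter, mem_univ, true_and] at hf
        exact ⟨hf.1.mono sdiff_subset, hf.2⟩)
    have h2 := hS _ hTS
    rw [hTcard] at h2
    rw [he i] at h1
    have h1' : (#(B i) : ℝ) * c ^ (k - 1) ≤
        #{f : α → Fin c | ProperOn e (S \ ((e i).erase v).erase w) f} := by exact_mod_cast h1
    rw [le_div_iff₀ hK]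
    calc (#(B i) : ℝ) * (c ^ (k - 1) * r ^ (k - 2))
        = r ^ (k - 2) * (#(B i) * c ^ (k - 1)) := by ring
      _ ≤ _ := mul_le_mul_of_nonneg_left h1' (by positivity)
      _ ≤ N := h2
  have hsum : N ≤ #{f : α → Fin c | ProperOn e (insert v S) f} + ∑ i ∈ I, (#(B i) : ℝ) := by
    have := (card_le_card hcover).trans ((card_union_le _ _).trans
      (Nat.add_le_add_left card_biUnion_le _))
    rw [hN]
    exact_mod_cast this
  have hsum2 : ∑ i ∈ I, (#(B i) : ℝ) ≤ (1 - r) * N := by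
    calc ∑ i ∈ I, (#(B i) : ℝ) ≤ #I * (N / (c ^ (k - 1) * r ^ (k - 2))) := by
          simpa using sum_le_sum hbad
      _ ≤ D * (N / (c ^ (k - 1) * r ^ (k - 2))) := by
          refine mul_le_mul_of_nonneg_right (le_trans ?_ (hdeg v)) (by positivity)
          exact_mod_cast card_le_card fun i hi => by
            simp only [hI, mem_filter, mem_univ, true_and] at hi ⊢
            exact hi.1
      _ ≤ (1 - r) * (c ^ (k - 1) * r ^ (k - 2)) * (N / (c ^ (k - 1) * r ^ (k - 2))) :=
          mul_le_mul_of_nonneg_right hD (by positivity)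
      _ = (1 - r) * N := by field_simp
  linarith

open Finset Classical in
theorem exists_properOn_univ {α ι : Type*} [Fintype α] [Fintype ι] {c k : ℕ} {D r : ℝ}
    (hc : 1 ≤ c) (hk : 2 ≤ k) (hr : 0 < r) (e : ι → Finset α) (he : ∀ i, #(e i) = k)
    (hdeg : ∀ v, (#{i | v ∈ e i} : ℝ) ≤ D)
    (hD : D ≤ (1 - r) * (c ^ (k - 1) * r ^ (k - 2))) :
    ∃ f : α → Fin c, ProperOn e univ f := by
  have key : ∀ S : Finset α, ∀ T ⊆ S,
      r ^ #T * #{f : α → Fin c | ProperOn e (S \ T) f} ≤ #{f : α → Fin c | ProperOn e S f} := by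
    intro S
    induction S using Finset.strongInduction with
    | H S ih =>
      intro T hT
      obtain rfl | ⟨v, hv⟩ := T.eq_empty_or_nonempty
      · simp
      have h1 := card_properOn_insert hc hk hr e he hdeg hD (S.erase v) v (notMem_erase v S)
        (ih _ (erase_ssubset (hT hv)))
      have h2 := ih _ (erase_ssubset (hT hv)) (T.erase v) (erase_subset_erase v hT)
      rw [insert_erase (hT hv)] at h1
      have h3 : S.erase v \ T.erase v = S \ T := by
        ext x
        simp only [mem_sdiff, mem_erase]
        by_cases hx : x = v
        · simp [hx, hv]
        · simp [hx]
      rw [h3] at h2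
      calc _ = r * (r ^ #(T.erase v) * #{f : α → Fin c | ProperOn e (S \ T) f}) := by
            rw [← card_erase_add_one hv]
            ring
        _ ≤ _ := mul_le_mul_of_nonneg_left h2 hr.le
        _ ≤ _ := h1
  have h := key univ univ subset_rfl
  have h0 : ∀ f : α → Fin c, ProperOn e ∅ f := by
    intro f i hi
    have := card_le_card hi
    rw [he i, card_empty] at this
    omega
  rw [sdiff_self, bot_eq_empty, filter_true_of_mem fun f _ => h0 f, card_univ (α := α → Fin c),
    Fintype.card_fun, Fintype.card_fin] at h
  have hpos : (0 : ℝ) < r ^ #(univ : Finset α) * ((c ^ Fintype.card α : ℕ) : ℝ) :=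
    mul_pos (pow_pos hr _) (by exact_mod_cast Nat.pow_pos hc)
  have h' : 0 < #{f : α → Fin c | ProperOn e univ f} := by exact_mod_cast hpos.trans_le h
  obtain ⟨f, hf⟩ := card_pos.1 h'
  exact ⟨f, (mem_filter.1 hf).2⟩

theorem inv_exp_one_le_pow (n : ℕ) : (Real.exp 1)⁻¹ ≤ (1 - ((n : ℝ) + 1)⁻¹) ^ n := by
  obtain rfl | hn := Nat.eq_zero_or_pos n
  · simpa using inv_le_one_of_one_le₀ (Real.one_le_exp zero_le_one)
  have hn' : (0 : ℝ) < n := by exact_mod_cast hn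
  have h1 : (1 - ((n : ℝ) + 1)⁻¹) = (1 + (n : ℝ)⁻¹)⁻¹ := by
    field_simp
    ring
  rw [h1, inv_pow]
  refine inv_anti₀ (by positivity) ?_
  calc (1 + (n : ℝ)⁻¹) ^ n ≤ Real.exp (n : ℝ)⁻¹ ^ n := by
        refine pow_le_pow_left₀ (by positivity) ?_ n
        linarith [Real.add_one_le_exp (n : ℝ)⁻¹]
    _ = Real.exp 1 := by
        rw [← Real.exp_nat_mul]
        congr 1
        field_simp

open Finset Classical in
/-- Each grid point lies in at most `∏ i, (a i - 1)` boxes. -/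
theorem card_boxes_mem_le {d : ℕ} {a : Fin d → ℕ} (v : (i : Fin d) → Fin (a i)) :
    #{p : {p : ((i : Fin d) → Fin (a i)) × ((i : Fin d) → Fin (a i)) // ∀ i, p.1 i < p.2 i} |
      v ∈ Fintype.piFinset fun i => ({p.1.1 i, p.1.2 i} : Finset (Fin (a i)))} ≤
      ∏ i, (a i - 1) := by
  have : ∏ i, (a i - 1) = #(Fintype.piFinset fun i => (univ : Finset (Fin (a i))).erase (v i)) := by
    simp
  rw [this]
  refine card_le_card_of_injOn (fun p i => if v i = p.1.1 i then p.1.2 i else p.1.1 i) ?_ ?_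
  · rintro ⟨⟨p, q⟩, hpq⟩ hv
    simp only [coe_filter, mem_univ, true_and, Set.mem_ofPred_eq, Fintype.mem_piFinset,
      mem_insert, mem_singleton] at hv
    simp only [mem_coe, Fintype.mem_piFinset, mem_erase, mem_univ, and_true]
    intro i
    have := hpq i
    split_ifs with h
    · rw [h]; exact this.ne'
    · exact fun h' => h h'.symm
  · rintro ⟨⟨p, q⟩, hpq⟩ hv ⟨⟨p', q'⟩, hpq'⟩ hv' h
    simp only [coe_filter, mem_univ, true_and, Set.mem_ofPred_eq, Fintype.mem_piFinset,
      mem_insert, mem_singleton] at hv hv'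
    have key : ∀ i, p i = p' i ∧ q i = q' i := by
      intro i
      have h1 := congrFun h i
      have h2 := hv i
      have h3 := hv' i
      have h4 := hpq i
      have h5 := hpq' i
      simp only at h1 h4 h5
      simp only [Fin.ext_iff, Fin.lt_def] at *
      split_ifs at h1 <;> omega
    exact Subtype.ext (Prod.ext (funext fun i => (key i).1) (funext fun i => (key i).2))

open Finset Classical in
theorem exists_coloring_of_prod_le {d c : ℕ} (hd : 1 ≤ d) (hc : 1 ≤ c) (a : Fin d → ℕ)
    (ha : ((∏ i, (a i - 1) : ℕ) : ℝ) ≤ (2 : ℝ)⁻¹ ^ d * (Real.exp 1)⁻¹ * c ^ (2 ^ d - 1)) :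
    ∃ f : GridPoint d a → Fin c, ∀ p, ¬ IsMonoBox f p := by
  have hk : 2 ≤ 2 ^ d := Nat.le_self_pow (by omega) 2
  have hk' : (2 : ℝ) ≤ 2 ^ d := by exact_mod_cast hk
  have hinv : ((2 : ℝ) ^ d)⁻¹ ≤ 2⁻¹ := inv_anti₀ (by norm_num) hk'
  have hpos : (0 : ℝ) < (2 ^ d)⁻¹ := by positivity
  obtain ⟨f, hf⟩ := exists_properOn_univ (c := c) (k := 2 ^ d) (r := 1 - ((2 : ℝ) ^ d)⁻¹)
    hc hk (by linarith)
    (fun p : {p : ((i : Fin d) → Fin (a i)) × ((i : Fin d) → Fin (a i)) //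
        ∀ i, p.1 i < p.2 i} =>
      Fintype.piFinset fun i => ({p.1.1 i, p.1.2 i} : Finset (Fin (a i))))
    (fun p => by
      rw [Fintype.card_piFinset, prod_congr rfl fun i _ => card_pair (p.2 i).ne]
      simp)
    (fun v => Nat.cast_le.2 (by convert card_boxes_mem_le v))
    (ha.trans (by
      have h1 := inv_exp_one_le_pow (2 ^ d - 1)
      have h2 : (((2 ^ d - 1 : ℕ) : ℝ) + 1) = 2 ^ d := by
        rw [Nat.cast_sub (by omega)]
        push_cast
        ring
      rw [h2] at h1
      have h3 : (1 - ((2 : ℝ) ^ d)⁻¹) ^ (2 ^ d - 1) ≤ (1 - ((2 : ℝ) ^ d)⁻¹) ^ (2 ^ d - 2) :=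
        pow_le_pow_of_le_one (by linarith) (by linarith) (by omega)
      calc (2 : ℝ)⁻¹ ^ d * (Real.exp 1)⁻¹ * c ^ (2 ^ d - 1)
          = ((2 : ℝ) ^ d)⁻¹ * c ^ (2 ^ d - 1) * (Real.exp 1)⁻¹ := by
            rw [inv_pow]
            ring
        _ ≤ ((2 : ℝ) ^ d)⁻¹ * c ^ (2 ^ d - 1) * (1 - ((2 : ℝ) ^ d)⁻¹) ^ (2 ^ d - 2) :=
            mul_le_mul_of_nonneg_left (h1.trans h3) (by positivity)
        _ = _ := by ring))
  refine ⟨f, ?_⟩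
  rintro ⟨p, q⟩ ⟨hpq, s, hs⟩
  refine hf ⟨⟨p, q⟩, hpq⟩ (subset_univ _) ⟨s, fun x hx => hs x fun i => ?_⟩
  simpa using Fintype.mem_piFinset.1 hx i

open Finset in
/-- Convexity bound for the number of pairs of distinct indices `l ≠ l'` with a common element of
`R l` and `R l'`. -/
theorem le_sum_card_offDiag {α : Type*} [DecidableEq α] (m : ℕ) (X : Finset α)
    (R : ℕ → Finset α) (hR : ∀ l, R l ⊆ X) {τ x : ℝ} (hx : 1 ≤ 2 * x)
    (hτ : ∀ l, τ ≤ #(R l)) :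
    (2 * x - 1) * (m * τ) - #X * x ^ 2 ≤
      ((∑ y ∈ X, #({l ∈ range m | y ∈ R l}.offDiag) : ℕ) : ℝ) := by
  have h1 : ∑ y ∈ X, (#{l ∈ range m | y ∈ R l} : ℝ) = ∑ l ∈ range m, (#(R l) : ℝ) := by
    have h := sum_card_bipartiteAbove_eq_sum_card_bipartiteBelow (s := X) (t := range m)
      (fun y l => y ∈ R l)
    have h' : ∀ l, bipartiteBelow (fun y l => y ∈ R l) X l = R l := fun l => by
      ext y
      simpa [bipartiteBelow] using fun hy => hR l hy
    simp only [h'] at h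
    exact_mod_cast h
  have h2 : m * τ ≤ ∑ l ∈ range m, (#(R l) : ℝ) := by
    simpa using card_nsmul_le_sum (range m) (fun l => (#(R l) : ℝ)) τ fun l _ => hτ l
  have h3 : ∀ y ∈ X, (2 * x - 1) * (#{l ∈ range m | y ∈ R l} : ℝ) - x ^ 2 ≤
      (#({l ∈ range m | y ∈ R l}.offDiag) : ℝ) := by
    intro y _
    rw [offDiag_card, Nat.cast_sub (Nat.le_mul_self _)]
    push_cast
    nlinarith [sq_nonneg ((#{l ∈ range m | y ∈ R l} : ℝ) - x)]
  have h4 := sum_le_sum h3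
  rw [sum_sub_distrib, ← mul_sum, h1, sum_const, nsmul_eq_mul] at h4
  push_cast
  nlinarith

open Finset in
/-- The triples `(p, q, s)` such that `p` and `q` are opposite corners of a box in the grid
`∏ i < n, {0, …, A i - 1}` on which `f` takes the constant value `s`. -/
noncomputable def orientedMonoBoxes (A : ℕ → ℕ) {c : ℕ} (n : ℕ) (f : (Fin n → ℕ) → Fin c) :
    Finset ((Fin n → ℕ) × (Fin n → ℕ) × Fin c) :=
  open Classical in
  {y ∈ (Fintype.piFinset fun i : Fin n => range (A i)) ×ˢ
      (Fintype.piFinset fun i : Fin n => range (A i)) ×ˢ (univ : Finset (Fin c)) |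
    (∀ i, y.1 i ≠ y.2.1 i) ∧ ∀ x, (∀ i, x i = y.1 i ∨ x i = y.2.1 i) → f x = y.2.2}

theorem mem_orientedMonoBoxes {A : ℕ → ℕ} {c n : ℕ} {f : (Fin n → ℕ) → Fin c}
    {y : (Fin n → ℕ) × (Fin n → ℕ) × Fin c} :
    y ∈ orientedMonoBoxes A n f ↔ ((∀ i, y.1 i < A i) ∧ ∀ i, y.2.1 i < A i) ∧
      (∀ i, y.1 i ≠ y.2.1 i) ∧ ∀ x, (∀ i, x i = y.1 i ∨ x i = y.2.1 i) → f x = y.2.2 := by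
  simp [orientedMonoBoxes]

open Finset in
theorem sum_card_offDiag_le_card_orientedMonoBoxes (A : ℕ → ℕ) {c : ℕ} (n : ℕ)
    (f : (Fin (n + 1) → ℕ) → Fin c) (X : Finset ((Fin n → ℕ) × (Fin n → ℕ) × Fin c)) :
    ∑ y ∈ X, #({l ∈ range (A n) |
        y ∈ orientedMonoBoxes A n fun x => f (Fin.snoc (α := fun _ => ℕ) x l)}.offDiag) ≤
      #(orientedMonoBoxes A (n + 1) f) := by
  rw [← card_sigma]
  refine card_le_card_of_injOn (fun z => (Fin.snoc (α := fun _ => ℕ) z.1.1 z.2.1,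
    Fin.snoc (α := fun _ => ℕ) z.1.2.1 z.2.2, z.1.2.2)) ?_ ?_
  · rintro ⟨⟨p, q, s⟩, l, l'⟩ hz
    simp only [mem_coe, mem_sigma, mem_offDiag, mem_filter, mem_range,
      mem_orientedMonoBoxes] at hz
    obtain ⟨-, ⟨hl, ⟨hp, hq⟩, hpq, h1⟩, ⟨hl', -, -, h2⟩, hne⟩ := hz
    simp only [mem_coe, mem_orientedMonoBoxes]
    refine ⟨⟨?_, ?_⟩, ?_, ?_⟩
    · intro i
      induction i using Fin.lastCases <;> simp [hl, hp]
    · intro i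
      induction i using Fin.lastCases <;> simp [hl', hq]
    · intro i
      induction i using Fin.lastCases <;> simp [hne, hpq]
    · intro x hx
      rw [← Fin.snoc_init_self x]
      have hinit : ∀ i, Fin.init x i = p i ∨ Fin.init x i = q i := fun i => by
        simpa [Fin.init] using hx i.castSucc
      have hlast := hx (Fin.last n)
      simp only [Fin.snoc_last] at hlast
      rcases hlast with h | h
      · rw [h]
        exact h1 _ hinit
      · rw [h]
        exact h2 _ hinit
  · rintro ⟨⟨p, q, s⟩, l, l'⟩ - ⟨⟨p', q', s'⟩, m, m'⟩ - h
    simp only [Prod.mk.injEq, Fin.snoc_inj] at h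
    obtain ⟨⟨rfl, rfl⟩, ⟨rfl, rfl⟩, rfl⟩ := h
    rfl

open Finset in
theorem le_card_orientedMonoBoxes_succ (A : ℕ → ℕ) {c : ℕ} (n : ℕ) {τ x : ℝ} (hx : 1 ≤ 2 * x)
    (hτ : ∀ f : (Fin n → ℕ) → Fin c, τ ≤ #(orientedMonoBoxes A n f))
    (f : (Fin (n + 1) → ℕ) → Fin c) :
    (2 * x - 1) * (A n * τ) - c * (∏ i : Fin n, (A i : ℝ)) ^ 2 * x ^ 2 ≤
      #(orientedMonoBoxes A (n + 1) f) := by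
  classical
  set P := Fintype.piFinset fun i : Fin n => range (A i) with hP
  have h := le_sum_card_offDiag (A n) (P ×ˢ P ×ˢ (univ : Finset (Fin c)))
    (fun l => orientedMonoBoxes A n fun x => f (Fin.snoc (α := fun _ => ℕ) x l))
    (fun l => filter_subset _ _) hx (fun l => hτ _)
  have h' : (#(P ×ˢ P ×ˢ (univ : Finset (Fin c))) : ℝ) = c * (∏ i : Fin n, (A i : ℝ)) ^ 2 := by
    simp [hP, card_product]
    ring
  rw [h'] at h
  exact h.trans (by exact_mod_cast sum_card_offDiag_le_card_orientedMonoBoxes A n f _)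

/-- The side lengths of a `d`-dimensional grid of small volume which is `c`-guaranteed. -/
def side (d c i : ℕ) : ℕ := (d + 2) * 2 ^ (d - 1 - i) * c ^ 2 ^ i

theorem side_pos {d c : ℕ} (hc : 0 < c) (i : ℕ) : 0 < side d c i := by
  unfold side
  positivity

theorem prod_side (d c : ℕ) :
    ∏ i : Fin d, side d c i = (d + 2) ^ d * 2 ^ (d * (d - 1) / 2) * c ^ (2 ^ d - 1) := by
  rw [Fin.prod_univ_eq_prod_range (side d c) d]
  simp only [side, Finset.prod_mul_distrib, Finset.prod_pow_eq_pow_sum, Finset.prod_const,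
    Finset.card_range]
  rw [Finset.sum_range_reflect (fun i => i) d, Finset.sum_range_id, Nat.geomSum_eq le_rfl]
  simp

open Finset in
theorem le_card_orientedMonoBoxes_side {d c : ℕ} (hc : 0 < c) (n : ℕ) (hn : n ≤ d)
    (f : (Fin n → ℕ) → Fin c) :
    (1 - n / ((d + 2) * 2 ^ (d - n))) * (∏ i : Fin n, (side d c i : ℝ)) ^ 2 /
      c ^ (2 ^ n - 1) ≤ (#(orientedMonoBoxes (side d c) n f) : ℝ) := by
  have hc' : (0 : ℝ) < c := by exact_mod_cast hc
  induction n with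
  | zero =>
    have h : (Fin.elim0, Fin.elim0, f Fin.elim0) ∈ orientedMonoBoxes (side d c) 0 f := by
      rw [mem_orientedMonoBoxes]
      exact ⟨⟨fun i => i.elim0, fun i => i.elim0⟩, fun i => i.elim0,
        fun x _ => congrArg f (Subsingleton.elim _ _)⟩
    simpa using card_pos.2 ⟨_, h⟩
  | succ n ih =>
    obtain ⟨m, rfl⟩ : ∃ m, d = n + 1 + m := ⟨d - (n + 1), by omega⟩
    have e1 : n + 1 + m - n = m + 1 := by omega
    have e2 : n + 1 + m - (n + 1) = m := by omega
    have e3 : n + 1 + m - 1 - n = m := by omega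
    have e4 : 2 ^ (n + 1) - 1 = (2 ^ n - 1) + (2 ^ n - 1) + 1 := by
      have := Nat.one_le_two_pow (n := n)
      rw [pow_succ]
      omega
    have e5 : 2 ^ n = (2 ^ n - 1) + 1 := by
      have := Nat.one_le_two_pow (n := n)
      omega
    have ih' := ih (by omega)
    rw [e1] at ih'
    rw [e2, e4, pow_succ (c : ℝ), pow_add (c : ℝ)]
    have hside : (side (n + 1 + m) c n : ℝ) =
        (((n + 1 + m : ℕ) : ℝ) + 2) * 2 ^ m * (c ^ (2 ^ n - 1) * c) := by
      rw [← pow_succ, ← e5, side, e3]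
      push_cast
      ring
    rw [Fin.prod_univ_castSucc]
    simp only [Fin.val_castSucc, Fin.val_last]
    rw [hside]
    set y : ℝ := (((n + 1 + m : ℕ) : ℝ) + 2) * 2 ^ m with hy
    set K : ℝ := (c : ℝ) ^ (2 ^ n - 1) with hK
    set M : ℝ := ∏ i : Fin n, (side (n + 1 + m) c i : ℝ) with hM
    have hK0 : 0 < K := by positivity
    have hyn : (n : ℝ) + 3 ≤ y := by
      have h1 : (1 : ℝ) ≤ 2 ^ m := one_le_pow₀ (by norm_num)
      have h2 : (n : ℝ) + 3 ≤ ((n + 1 + m : ℕ) : ℝ) + 2 := by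
        push_cast
        linarith [(Nat.cast_nonneg m : (0 : ℝ) ≤ m)]
      nlinarith [(Nat.cast_nonneg n : (0 : ℝ) ≤ n)]
    have hn0 : (0 : ℝ) ≤ n := Nat.cast_nonneg n
    have hy0 : 0 < y := by linarith
    have hy2 : (((n + 1 + m : ℕ) : ℝ) + 2) * 2 ^ (m + 1) = 2 * y := by
      rw [hy]
      ring
    rw [hy2] at ih'
    have h := le_card_orientedMonoBoxes_succ (side (n + 1 + m) c) n (x := y - n / 2)
      (by linarith) ih' f
    refine le_trans (b := (c * M ^ 2) * (y ^ 2 - (n + 1) * y)) (le_of_eq ?_) (le_trans ?_ h)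
    · push_cast
      field_simp
    · rw [hside, ← hM]
      have : (y * (K * c)) * ((1 - n / (2 * y)) * M ^ 2 / K) = c * M ^ 2 * (y - n / 2) := by
        field_simp
      rw [this]
      have h0 : 0 ≤ c * M ^ 2 := by positivity
      have h1 : y ^ 2 - (n + 1) * y ≤ (y - n / 2) ^ 2 - (y - n / 2) := by nlinarith
      nlinarith [mul_le_mul_of_nonneg_left h1 h0]

open Finset in
theorem exists_isMonoBox_side {d c : ℕ} (hc : 0 < c)
    (f : GridPoint d (fun i => side d c i) → Fin c) : ∃ p, IsMonoBox f p := by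
  have h := le_card_orientedMonoBoxes_side hc d le_rfl
    (fun x => f fun i => ⟨x i % side d c i, Nat.mod_lt _ (side_pos hc i)⟩)
  have hpos : (0 : ℝ) < (1 - d / ((d + 2) * 2 ^ (d - d))) *
      (∏ i : Fin d, (side d c i : ℝ)) ^ 2 / c ^ (2 ^ d - 1) := by
    have hc' : (0 : ℝ) < c := by exact_mod_cast hc
    have h1 : (0 : ℝ) < ∏ i : Fin d, (side d c i : ℝ) :=
      prod_pos fun i _ => by exact_mod_cast side_pos hc i
    have h2 : (0 : ℝ) < 1 - d / ((d + 2) * 2 ^ (d - d)) := by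
      rw [Nat.sub_self, pow_zero, mul_one, sub_pos, div_lt_one (by positivity)]
      linarith
    positivity
  obtain ⟨⟨p, q, s⟩, hy⟩ := card_pos.1 (by exact_mod_cast hpos.trans_le h :
    0 < #(orientedMonoBoxes (side d c) d
      (fun x => f fun i => ⟨x i % side d c i, Nat.mod_lt _ (side_pos hc i)⟩)))
  rw [mem_orientedMonoBoxes] at hy
  obtain ⟨⟨hp, hq⟩, hne, hs⟩ := hy
  refine ⟨(fun i => ⟨min (p i) (q i), min_lt_of_left_lt (hp i)⟩,
    fun i => ⟨max (p i) (q i), max_lt (hp i) (hq i)⟩), fun i => ?_, s, fun x hx => ?_⟩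
  · exact Fin.mk_lt_mk.2 (min_lt_max.2 (hne i))
  · have h1 := hs (fun i => (x i : ℕ)) fun i => by
      rcases hx i with h | h
      · have h' : (x i : ℕ) = min (p i) (q i) := congrArg Fin.val h
        simp only
        omega
      · have h' : (x i : ℕ) = max (p i) (q i) := congrArg Fin.val h
        simp only
        omega
    refine Eq.trans ?_ h1
    refine congrArg f (funext fun i => Fin.ext ?_)
    exact (Nat.mod_eq_of_lt (x i).2).symm

/-- `2^{-d} e^{-1} < V(c,d) / c^(2^d - 1) < (d+2)^d 2^(d(d-1)/2)`, where
`V(c,d)` is the largest `V` such that every `d`-dimensional grid of volume at most `V`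
is `c`-colorable. -/
theorem V_bounds (d c : ℕ) (hd : 1 ≤ d) (hc : 2 ≤ c) (V : ℕ)
    (hV : IsGreatest {W : ℕ | ∀ a : Fin d → ℕ, (∀ i, 1 ≤ a i) → (∏ i, a i) ≤ W →
      ∃ f : GridPoint d a → Fin c, ∀ p, ¬ IsMonoBox f p} V) :
    (2 : ℝ)⁻¹ ^ d * (Real.exp 1)⁻¹ < (V : ℝ) / (c : ℝ) ^ (2 ^ d - 1) ∧
      (V : ℝ) / (c : ℝ) ^ (2 ^ d - 1) < ((d : ℝ) + 2) ^ d * 2 ^ (d * (d - 1) / 2) := by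
  have hc0 : (0 : ℝ) < (c : ℝ) ^ (2 ^ d - 1) := by
    have : (0 : ℝ) < c := by exact_mod_cast (by omega : 0 < c)
    positivity
  constructor
  · rw [lt_div_iff₀ hc0]
    set x : ℝ := (2 : ℝ)⁻¹ ^ d * (Real.exp 1)⁻¹ * (c : ℝ) ^ (2 ^ d - 1) with hx
    have hx0 : 0 ≤ x := by positivity
    have hmem : ⌊x⌋₊ + 1 ≤ V := by
      refine hV.2 fun a ha hprod => exists_coloring_of_prod_le hd (by omega) a ?_
      have hlt : ∏ i, (a i - 1) < ∏ i, a i := by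
        by_cases h : ∃ i, a i = 1
        · obtain ⟨i, hi⟩ := h
          rw [Finset.prod_eq_zero (Finset.mem_univ i) (by omega)]
          exact Finset.prod_pos fun i _ => ha i
        · push Not at h
          exact Finset.prod_lt_prod_of_nonempty
            (fun i _ => by have := ha i; have := h i; omega)
            (fun i _ => by have := ha i; omega) ⟨⟨0, hd⟩, Finset.mem_univ _⟩
      exact (Nat.le_floor_iff hx0).1 (by omega)
    calc x < (⌊x⌋₊ : ℝ) + 1 := Nat.lt_floor_add_one x
      _ ≤ V := by exact_mod_cast hmem
  · have hlt : V < (d + 2) ^ d * 2 ^ (d * (d - 1) / 2) * c ^ (2 ^ d - 1) := by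
      by_contra! hle
      obtain ⟨f, hf⟩ := hV.1 (fun i => side d c i) (fun i => side_pos (by omega) i)
        (by rwa [prod_side])
      obtain ⟨p, hp⟩ := exists_isMonoBox_side (by omega) f
      exact hf p hp
    rw [div_lt_iff₀ hc0]
    exact_mod_cast hlt
end

section
/- For all integers d ≥ 1 and c ≥ 2, the grid [a_1,…,a_d] with side lengths a_j = (d+1)·2^{d−j}·c^{2^{j−1}} + 1 for 1 ≤ j ≤ d is c-guaranteed. -/
/-- The nondegenerate boxes of the grid with side lengths `N i + 1`, as coordinatewise ordered
pairs of distinct values, so that each combinatorial box is represented `2 ^ k` times. -/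
abbrev OrderedBox (N : ℕ → ℕ) (k : ℕ) : Type :=
  (i : Fin k) → {q : Fin (N i + 1) × Fin (N i + 1) // q.1 ≠ q.2}

/-- All corners of the box `B` have color `s`. -/
def IsMonoOrderedBox {N : ℕ → ℕ} {k c : ℕ} (f : ((i : Fin k) → Fin (N i + 1)) → Fin c)
    (B : OrderedBox N k × Fin c) : Prop :=
  ∀ x, (∀ i, x i = (B.1 i).1.1 ∨ x i = (B.1 i).1.2) → f x = B.2

lemma card_ordered_pairs (n : ℕ) :
    Fintype.card {q : Fin (n + 1) × Fin (n + 1) // q.1 ≠ q.2} = (n + 1) * n := by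
  have h := Finset.offDiag_card (Finset.univ : Finset (Fin (n + 1)))
  rw [Fintype.card_subtype]
  convert h using 2
  · ext q
    simp
  · simp [Nat.mul_succ]

lemma card_orderedBox_succ (N : ℕ → ℕ) (k : ℕ) :
    Fintype.card (OrderedBox N (k + 1)) = Fintype.card (OrderedBox N k) * ((N k + 1) * N k) := by
  simp only [OrderedBox, Fintype.card_pi, card_ordered_pairs, Fin.prod_univ_castSucc,
    Fin.val_castSucc, Fin.val_last]

/-- If every `y : Y` is related to at least `t` elements of `I`, then the number of
triples `(i, y, z)` with `y ≠ z` both related to `i` is at least what the quadratic mean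
inequality predicts. -/
lemma sq_sub_le_card_vertical_pairs {I Y : Type*} [Fintype I] [Fintype Y] [DecidableEq Y]
    (R : I → Y → Prop) [∀ i y, Decidable (R i y)] (t : ℝ)
    (ht : ∀ y, t ≤ Fintype.card {i // R i y})
    (hI : (Fintype.card I : ℝ) ≤ Fintype.card Y * t) :
    Fintype.card Y * t * (Fintype.card Y * t - Fintype.card I) ≤
      Fintype.card I *
        Fintype.card {z : I × {q : Y × Y // q.1 ≠ q.2} // R z.1 z.2.1.1 ∧ R z.1 z.2.1.2} := by
  set m : I → ℝ := fun i => (Finset.univ.filter (R i)).card with hm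
  have hS : Fintype.card Y * t ≤ ∑ i, m i := by
    have h : ∑ i, m i = ∑ y, (Fintype.card {i // R i y} : ℝ) := by
      simp only [hm, Fintype.card_subtype, Finset.card_filter, Nat.cast_sum]
      exact Finset.sum_comm
    rw [h, ← nsmul_eq_mul]
    exact Finset.card_nsmul_le_sum _ _ _ fun y _ => ht y
  have hC : (∑ i, m i) ^ 2 ≤ Fintype.card I * ∑ i, m i ^ 2 :=
    sq_sum_le_card_mul_sum_sq
  have hW : (Fintype.card {z : I × {q : Y × Y // q.1 ≠ q.2} // R z.1 z.2.1.1 ∧ R z.1 z.2.1.2} : ℝ)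
      = ∑ i, m i ^ 2 - ∑ i, m i := by
    let e : {z : I × {q : Y × Y // q.1 ≠ q.2} // R z.1 z.2.1.1 ∧ R z.1 z.2.1.2} ≃
        (i : I) × {q : Y × Y // q ∈ (Finset.univ.filter (R i)).offDiag} :=
      { toFun := fun z => ⟨z.1.1, z.1.2.1, by
          have := z.2
          have := z.1.2.2
          simp_all⟩
        invFun := fun w => ⟨(w.1, ⟨w.2.1, by
          have := w.2.2
          simp only [Finset.mem_offDiag] at this
          exact this.2.2⟩), by
          have := w.2.2
          simp only [Finset.mem_offDiag, Finset.mem_filter] at this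
          exact ⟨this.1.2, this.2.1.2⟩⟩
        left_inv := fun _ => rfl
        right_inv := fun _ => rfl }
    rw [Fintype.card_congr e, Fintype.card_sigma, Nat.cast_sum, ← Finset.sum_sub_distrib]
    refine Finset.sum_congr rfl fun i _ => ?_
    rw [Fintype.card_coe, Finset.offDiag_card, Nat.cast_sub (Nat.le_mul_self _)]
    simp only [hm, Nat.cast_mul, sq]
  rw [hW]
  have h0 : (0 : ℝ) ≤ Fintype.card I := Nat.cast_nonneg _
  have := mul_le_mul hS (sub_le_sub_right hS (Fintype.card I : ℝ)) (by linarith)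
    (by linarith)
  nlinarith

open Classical in
/-- A box that is monochromatic in two parallel layers, with the same color, extends to a
monochromatic box of the next dimension. -/
lemma card_vertical_pairs_le {N : ℕ → ℕ} {k c : ℕ}
    (f : ((i : Fin (k + 1)) → Fin (N i + 1)) → Fin c)
    (R : OrderedBox N k × Fin c → Fin (N k + 1) → Prop)
    (hR : ∀ B y, R B y ↔ IsMonoOrderedBox
      (fun x => f (Fin.snoc (α := fun i : Fin (k + 1) => Fin (N i + 1)) x y)) B) :
    Fintype.card {z : (OrderedBox N k × Fin c) ×
        {q : Fin (N k + 1) × Fin (N k + 1) // q.1 ≠ q.2} // R z.1 z.2.1.1 ∧ R z.1 z.2.1.2} ≤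
      Fintype.card {B : OrderedBox N (k + 1) × Fin c // IsMonoOrderedBox f B} := by
  let β : Fin (k + 1) → Type := fun i => {q : Fin (N i + 1) × Fin (N i + 1) // q.1 ≠ q.2}
  refine Fintype.card_le_of_injective
    (fun z => ⟨(Fin.snoc (α := β) z.1.1.1 z.1.2, z.1.1.2), ?_⟩) ?_
  · intro x hx
    obtain ⟨h₁, h₂⟩ := z.2
    rw [hR] at h₁ h₂
    have hcorner : ∀ i : Fin k,
        x i.castSucc = (z.1.1.1 i).1.1 ∨ x i.castSucc = (z.1.1.1 i).1.2 := by
      intro i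
      have := hx i.castSucc
      simp only [Fin.snoc_castSucc (α := β)] at this
      exact this
    have hlast := hx (Fin.last k)
    simp only [Fin.snoc_last (α := β)] at hlast
    have hx' := Fin.snoc_init_self (α := fun i : Fin (k + 1) => Fin (N i + 1)) x
    rcases hlast with h | h
    · have := h₁ _ hcorner
      rw [← h] at this
      rw [← hx']
      exact this
    · have := h₂ _ hcorner
      rw [← h] at this
      rw [← hx']
      exact this
  · rintro ⟨⟨⟨p, s⟩, q⟩, h⟩ ⟨⟨⟨p', s'⟩, q'⟩, h'⟩ heq
    have heq' := congrArg Subtype.val heq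
    have hb := congrArg Prod.fst heq'
    have hs := congrArg Prod.snd heq'
    simp only [Subtype.mk.injEq, Prod.mk.injEq]
    have := Fin.snoc_injective2 (α := β) hb
    exact ⟨⟨this.1, hs⟩, this.2⟩

open Classical in
/-- Monochromatic boxes have at least `1 - k * 2 ^ k / ((d + 1) * 2 ^ d)` times the density
`c / c ^ 2 ^ k` expected of a random coloring. -/
lemma density_mono_orderedBox_ge (d c : ℕ) (hc : 0 < c) (N : ℕ → ℕ)
    (hN : ∀ j, N j = (d + 1) * 2 ^ (d - 1 - j) * c ^ (2 ^ j)) (k : ℕ) (hk : k ≤ d)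
    (f : ((i : Fin k) → Fin (N i + 1)) → Fin c) :
    (1 - k * 2 ^ k / ((d + 1) * 2 ^ d) : ℝ) * (c * Fintype.card (OrderedBox N k)) ≤
      Fintype.card {B : OrderedBox N k × Fin c // IsMonoOrderedBox f B} * c ^ (2 ^ k) := by
  induction k with
  | zero =>
    have : 0 < Fintype.card {B : OrderedBox N 0 × Fin c // IsMonoOrderedBox f B} :=
      Fintype.card_pos_iff.mpr ⟨⟨(finZeroElim, f finZeroElim), fun x _ =>
        congrArg f (Subsingleton.elim _ _)⟩⟩
    have h1 : (1 : ℝ) ≤ Fintype.card {B : OrderedBox N 0 × Fin c // IsMonoOrderedBox f B} := by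
      exact_mod_cast this
    have hc' : (0 : ℝ) ≤ c := Nat.cast_nonneg c
    simp only [OrderedBox, Fintype.card_pi, Finset.univ_eq_empty, Finset.prod_empty]
    norm_num
    nlinarith
  | succ k ih =>
    set R : OrderedBox N k × Fin c → Fin (N k + 1) → Prop := fun B y => IsMonoOrderedBox
      (fun x => f (Fin.snoc (α := fun i : Fin (k + 1) => Fin (N i + 1)) x y)) B
    have hW := card_vertical_pairs_le f R fun _ _ => Iff.rfl
    set C : ℝ := (c : ℝ) ^ (2 ^ k) with hC
    have hcpos : (0 : ℝ) < c := by exact_mod_cast hc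
    have hCpos : 0 < C := by positivity
    set I : ℝ := c * Fintype.card (OrderedBox N k) with hI
    have hI0 : 0 < I := by
      have : 0 < Fintype.card (OrderedBox N k) := by
        simp only [OrderedBox, Fintype.card_pi, card_ordered_pairs, hN]
        positivity
      positivity
    have hIcard : (Fintype.card (OrderedBox N k × Fin c) : ℝ) = I := by
      simp [hI, mul_comm]
    set x : ℝ := 2 ^ (k + 1) / ((d + 1) * 2 ^ d) with hx
    set r : ℝ := 1 - k * 2 ^ k / ((d + 1) * 2 ^ d) with hr
    have hxpos : 0 < x := by positivity
    have hrx : r = 1 - k * x / 2 := by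
      rw [hr, hx, pow_succ]; ring
    have hNx : (N k : ℝ) * x = C := by
      obtain ⟨e, rfl⟩ : ∃ e, d = k + 1 + e := ⟨d - (k + 1), by omega⟩
      have : k + 1 + e - 1 - k = e := by omega
      rw [hN, this, hx]
      push_cast
      rw [pow_add 2 (k + 1) e]
      field_simp
      exact hC.symm
    have hxle : x * (d + 1) ≤ 1 := by
      have : x * (d + 1) = 2 ^ (k + 1) / 2 ^ d := by rw [hx]; field_simp
      rw [this, div_le_one (by positivity)]
      exact pow_le_pow_right₀ (by norm_num) hk
    have hkd : (k : ℝ) + 1 ≤ d := by exact_mod_cast hk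
    have hk0 : (0 : ℝ) ≤ k := Nat.cast_nonneg k
    have hrgt : x ≤ r := by rw [hrx]; nlinarith
    have hN0 : (0 : ℝ) ≤ N k := Nat.cast_nonneg _
    have ht : ∀ y, r * I / C ≤ Fintype.card {B // R B y} := by
      intro y
      rw [div_le_iff₀ hCpos]
      exact ih (by omega) _
    have hnr : C ≤ (N k + 1) * r := by nlinarith
    have key := sq_sub_le_card_vertical_pairs R (r * I / C) ht (by
      rw [hIcard, Fintype.card_fin, ← mul_div_assoc, le_div_iff₀ hCpos]
      push_cast
      nlinarith)
    rw [hIcard, Fintype.card_fin] at key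
    push_cast at key
    set V : ℝ := (Fintype.card {z : (OrderedBox N k × Fin c) ×
        {q : Fin (N k + 1) × Fin (N k + 1) // q.1 ≠ q.2} // R z.1 z.2.1.1 ∧ R z.1 z.2.1.2} : ℝ)
    have hV : I * ((N k + 1) * r * ((N k + 1) * r - C)) ≤ V * C ^ 2 := by
      have h := mul_le_mul_of_nonneg_right key (sq_nonneg C)
      have h' : ((N k + 1 : ℝ) * (r * I / C) * ((N k + 1) * (r * I / C) - I)) * C ^ 2 =
          I * (I * ((N k + 1) * r * ((N k + 1) * r - C))) := by
        field_simp
      rw [h', mul_assoc I V] at h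
      exact le_of_mul_le_mul_left h hI0
    have hr' : (1 - (k + 1) * x) * N k ≤ r * ((N k + 1) * r - C) := by
      have h1 : 1 - (k + 1) * x ≤ r * (r - x) := by
        rw [hrx]
        nlinarith [mul_nonneg hk0 (sq_nonneg x), sq_nonneg (k * x)]
      have h2 := mul_le_mul_of_nonneg_right h1 hN0
      rw [← hNx]
      nlinarith [sq_nonneg r]
    have hgoal : (1 - ((k + 1 : ℕ) : ℝ) * 2 ^ (k + 1) / ((d + 1) * 2 ^ d)) *
        (c * Fintype.card (OrderedBox N (k + 1))) =
        I * ((N k + 1) * ((1 - (k + 1) * x) * N k)) := by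
      rw [card_orderedBox_succ, hI, hx]
      push_cast
      ring
    rw [hgoal, pow_succ 2 k, pow_mul]
    calc I * ((N k + 1) * ((1 - (k + 1) * x) * N k))
        ≤ I * ((N k + 1) * (r * ((N k + 1) * r - C))) := by gcongr
      _ = I * ((N k + 1) * r * ((N k + 1) * r - C)) := by ring
      _ ≤ V * C ^ 2 := hV
      _ ≤ _ := by
        gcongr
        exact Nat.cast_le.mpr hW

/-- The two corners of a nondegenerate box can be taken coordinatewise ordered. -/
lemma exists_isMonoBox_of_ne {d c : ℕ} {a : Fin d → ℕ} (f : GridPoint d a → Fin c)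
    (p q : GridPoint d a) (hne : ∀ i, p i ≠ q i) (s : Fin c)
    (h : ∀ x : GridPoint d a, (∀ i, x i = p i ∨ x i = q i) → f x = s) :
    ∃ b, IsMonoBox f b := by
  refine ⟨(fun i => min (p i) (q i), fun i => max (p i) (q i)),
    fun i => min_lt_max.mpr (hne i), s, fun x hx => h x fun i => ?_⟩
  have := hx i
  rcases le_total (p i) (q i) with hle | hle
  · simpa [hle] using this
  · simpa [hle, or_comm] using this

/-- the grid with sides `a_j = (d+1) 2^(d-j) c^(2^(j-1)) + 1`, `1 ≤ j ≤ d`,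
is `c`-guaranteed.  (Here `j : Fin d` corresponds to the paper's index `j+1`.) -/
theorem explicit_guaranteed_grid (d c : ℕ) (hd : 1 ≤ d) (hc : 2 ≤ c) :
    Guaranteed d
      (fun j : Fin d => (d + 1) * 2 ^ (d - 1 - (j : ℕ)) * c ^ (2 ^ (j : ℕ)) + 1) c 1 := by
  intro f
  have hfin : (monoBoxSet f).Finite := by
    unfold GridPoint
    exact Set.toFinite _
  refine Nat.one_le_iff_ne_zero.mpr ((Set.ncard_pos hfin).mpr ?_).ne'
  classical
  let N : ℕ → ℕ := fun j => (d + 1) * 2 ^ (d - 1 - j) * c ^ (2 ^ j)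
  have hcpos : 0 < c := by omega
  have key := density_mono_orderedBox_ge d c hcpos N (fun _ => rfl) d le_rfl f
  have hM : 0 < Fintype.card (OrderedBox N d) := by
    simp only [OrderedBox, Fintype.card_pi, card_ordered_pairs, N]
    positivity
  have hpos : (0 : ℝ) < (1 - d * 2 ^ d / ((d + 1) * 2 ^ d)) *
      (c * Fintype.card (OrderedBox N d)) := by
    have : (1 - d * 2 ^ d / ((d + 1) * 2 ^ d) : ℝ) = 1 / (d + 1) := by
      field_simp
      ring
    rw [this]
    positivity
  have hcard : 0 < Fintype.card {B : OrderedBox N d × Fin c // IsMonoOrderedBox f B} := by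
    rw [Nat.pos_iff_ne_zero]
    intro h0
    rw [h0, Nat.cast_zero, zero_mul] at key
    exact absurd key (not_le.mpr hpos)
  obtain ⟨⟨B, s⟩, hB⟩ := Fintype.card_pos_iff.mp hcard
  exact exists_isMonoBox_of_ne f (fun i => (B i).1.1) (fun i => (B i).1.2)
    (fun i => (B i).2) s hB
end

section
/- Let c ≥ 1 and d ≥ 2 be integers, let a_1,…,a_d ≥ 2 be integers, and let j be an integer with 1 ≤ j ≤ d−1. Set c′ := c · ∏_{i=1}^j binom(a_i,2). If the j-dimensional grid [a_1,…,a_j] is c-guaranteed and the (d−j)-dimensional grid [a_{j+1},…,a_d] is c′-guaranteed, then the d-dimensional grid [a_1,…,a_d] is c-guaranteed. -/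
theorem guaranteed_one_iff {d : ℕ} {a : Fin d → ℕ} {c : ℕ} :
    Guaranteed d a c 1 ↔ ∀ f : GridPoint d a → Fin c, ∃ p, IsMonoBox f p := by
  have : Finite (GridPoint d a) := inferInstanceAs (Finite ((i : Fin d) → Fin (a i)))
  refine forall_congr' fun f => ?_
  rw [Nat.one_le_iff_ne_zero, ← Nat.pos_iff_ne_zero, Set.ncard_pos (Set.toFinite _)]
  rfl

/-- A point of the grid `a` assembled from its coordinates along the two parts of a
partition of the index set. -/
def GridPoint.glue {d j k : ℕ} {a : Fin d → ℕ} (σ : Fin j ⊕ Fin k ≃ Fin d)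
    (x : GridPoint j fun i => a (σ (.inl i))) (y : GridPoint k fun i => a (σ (.inr i))) :
    GridPoint d a :=
  Equiv.piCongrLeft (fun i => Fin (a i)) σ (Sum.rec x y)

namespace GridPoint

variable {d j k : ℕ} {a : Fin d → ℕ} (σ : Fin j ⊕ Fin k ≃ Fin d)
  (x : GridPoint j fun i => a (σ (.inl i))) (y : GridPoint k fun i => a (σ (.inr i)))

@[simp]
theorem glue_inl (i : Fin j) : glue σ x y (σ (.inl i)) = x i :=
  Equiv.piCongrLeft_apply_apply (fun i => Fin (a i)) σ _ _

@[simp]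
theorem glue_inr (i : Fin k) : glue σ x y (σ (.inr i)) = y i :=
  Equiv.piCongrLeft_apply_apply (fun i => Fin (a i)) σ _ _

theorem glue_restrict (z : GridPoint d a) :
    glue σ (fun i => z (σ (.inl i))) (fun i => z (σ (.inr i))) = z := by
  funext i
  obtain ⟨i | i, rfl⟩ := σ.surjective i
  · exact glue_inl σ _ _ i
  · exact glue_inr σ _ _ i

end GridPoint

open GridPoint in
theorem Guaranteed.of_sum_equiv {d j k c : ℕ} {a : Fin d → ℕ} (σ : Fin j ⊕ Fin k ≃ Fin d)
    (h1 : Guaranteed j (fun i => a (σ (.inl i))) c 1)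
    (h2 : Guaranteed k (fun i => a (σ (.inr i))) (c * ∏ i, (a (σ (.inl i))).choose 2) 1) :
    Guaranteed d a c 1 := by
  rw [guaranteed_one_iff] at h1 h2 ⊢
  intro f
  choose P hlt s hs using fun y => h1 fun x => f (glue σ x y)
  -- The virtual color of `y` records a monochromatic box in the fiber over `y` and its color.
  let V := Fin c × ((i : Fin j) → {t : Finset (Fin (a (σ (.inl i)))) // t.card = 2})
  have hV : Fintype.card V = c * ∏ i, (a (σ (.inl i))).choose 2 := by
    simp [V, Fintype.card_finset_len]
  let e : V ≃ Fin (c * ∏ i, (a (σ (.inl i))).choose 2) := Fintype.equivFinOfCardEq hV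
  let g : GridPoint k (fun i => a (σ (.inr i))) → V := fun y =>
    (s y, fun i => ⟨{(P y).1 i, (P y).2 i}, Finset.card_pair (hlt y i).ne⟩)
  obtain ⟨q, hq, r, hr⟩ := h2 fun y => e (g y)
  have hg : ∀ y, (∀ i, y i = q.1 i ∨ y i = q.2 i) → g y = g q.1 := fun y hy =>
    e.injective ((hr y hy).trans (hr q.1 fun _ => .inl rfl).symm)
  refine ⟨(glue σ (P q.1).1 q.1, glue σ (P q.1).2 q.2), fun i => ?_, s q.1, fun z hz => ?_⟩
  · obtain ⟨i | i, rfl⟩ := σ.surjective i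
    · simpa using hlt q.1 i
    · simpa using hq i
  · have hy := hg (fun i => z (σ (.inr i))) fun i => by simpa using hz (σ (.inr i))
    have hcolor := congrArg Prod.fst hy
    rw [← glue_restrict σ z]
    refine (hs _ _ fun i => ?_).trans hcolor
    have hpair := congrArg Subtype.val (congrFun (congrArg Prod.snd hy) i)
    have hmem := congrArg (z (σ (.inl i)) ∈ ·) hpair
    have hzi := hz (σ (.inl i))
    simp only [glue_inl] at hzi
    simpa [g, hzi] using hmem

/-- virtual colors: if `[a_1,…,a_j]` is `c`-guaranteed and
`[a_{j+1},…,a_d]` is `c'`-guaranteed with `c' = c ∏_{i=1}^j (a_i choose 2)`, then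
`[a_1,…,a_d]` is `c`-guaranteed. -/
theorem virtual_colors (c d j : ℕ) (hc : 1 ≤ c) (hd : 2 ≤ d) (hj1 : 1 ≤ j) (hjd : j ≤ d - 1)
    (a : Fin d → ℕ) (ha : ∀ i, 2 ≤ a i)
    (h1 : Guaranteed j (fun i : Fin j => a ⟨i.val, by have := i.isLt; omega⟩) c 1)
    (h2 : Guaranteed (d - j) (fun i : Fin (d - j) => a ⟨j + i.val, by have := i.isLt; omega⟩)
      (c * ∏ i : Fin j, (a ⟨i.val, by have := i.isLt; omega⟩).choose 2) 1) :
    Guaranteed d a c 1 := by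
  have hsum : j + (d - j) = d := by omega
  exact Guaranteed.of_sum_equiv (finSumFinEquiv.trans (finCongr hsum)) h1 h2
end

section
/- Fix an integer d ≥ 1 and define C_j = (d·2^d)^{(3/2)(3^{j−1}−1)} for j ≥ 1. For all integers c ≥ 1 and 1 ≤ a_1 ≤ a_2 ≤ ⋯ ≤ a_d, if ∏_{i=1}^j a_i > C_j · c^{(3^j−1)/2} for every j with 1 ≤ j ≤ d, then the grid [a_1,…,a_d] is c-guaranteed. -/
/-- Every vertex of the box spanned by the corners `p.1` and `p.2` has color `s`. -/
def BoxHasColor {n c : ℕ} (f : (Fin n → ℕ) → Fin c) (p : (Fin n → ℕ) × (Fin n → ℕ))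
    (s : Fin c) : Prop :=
  ∀ x : Fin n → ℕ, (∀ i, x i = p.1 i ∨ x i = p.2 i) → f x = s

open Classical in
/-- The boxes of the grid with sides `a 0, …, a (n - 1)`. -/
noncomputable def gridBoxes (a : ℕ → ℕ) (n : ℕ) : Finset ((Fin n → ℕ) × (Fin n → ℕ)) :=
  ((Fintype.piFinset fun i : Fin n => Finset.range (a i)) ×ˢ
    (Fintype.piFinset fun i : Fin n => Finset.range (a i))).filter fun p => ∀ i, p.1 i < p.2 i

open Classical in
/-- The monochromatic boxes of the grid with sides `a 0, …, a (n - 1)`. -/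
noncomputable def monoGridBoxes (a : ℕ → ℕ) {n c : ℕ} (f : (Fin n → ℕ) → Fin c) :
    Finset ((Fin n → ℕ) × (Fin n → ℕ)) :=
  (gridBoxes a n).filter fun p => ∃ s, BoxHasColor f p s

/-- The restriction of a coloring to the layer with last coordinate `y`. -/
def layer {n c : ℕ} (f : (Fin (n + 1) → ℕ) → Fin c) (y : ℕ) : (Fin n → ℕ) → Fin c :=
  fun x => f (Fin.snoc x y)

lemma mem_gridBoxes {a : ℕ → ℕ} {n : ℕ} {p : (Fin n → ℕ) × (Fin n → ℕ)} :
    p ∈ gridBoxes a n ↔ ∀ i, p.1 i < p.2 i ∧ p.2 i < a i := by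
  simp only [gridBoxes, Finset.mem_filter, Finset.mem_product, Fintype.mem_piFinset,
    Finset.mem_range]
  exact ⟨fun h i => ⟨h.2 i, h.1.2 i⟩,
    fun h => ⟨⟨fun i => (h i).1.trans (h i).2, fun i => (h i).2⟩, fun i => (h i).1⟩⟩

lemma mem_monoGridBoxes {a : ℕ → ℕ} {n c : ℕ} {f : (Fin n → ℕ) → Fin c}
    {p : (Fin n → ℕ) × (Fin n → ℕ)} :
    p ∈ monoGridBoxes a f ↔ p ∈ gridBoxes a n ∧ ∃ s, BoxHasColor f p s := by
  simp [monoGridBoxes]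

/-- The increasing pairs of elements of `s`. -/
def ltPairs (s : Finset ℕ) : Finset (ℕ × ℕ) := (s ×ˢ s).filter fun q => q.1 < q.2

lemma two_mul_card_ltPairs (s : Finset ℕ) : 2 * (ltPairs s).card + s.card = s.card ^ 2 := by
  have hgt : (s.offDiag.filter fun q => ¬ q.1 < q.2).card = (ltPairs s).card := by
    refine Finset.card_bij' (fun q _ => q.swap) (fun q _ => q.swap) ?_ ?_ ?_ ?_ <;>
      simp [ltPairs] <;> grind
  have hlt : s.offDiag.filter (fun q => q.1 < q.2) = ltPairs s := by
    ext q
    simp [ltPairs]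
    grind
  have h := Finset.card_filter_add_card_filter_not (s := s.offDiag) fun q => q.1 < q.2
  rw [hgt, hlt, Finset.offDiag_card] at h
  have := Nat.le_mul_self s.card
  rw [sq]
  omega

lemma card_gridBoxes_zero_le (a : ℕ → ℕ) : (gridBoxes a 0).card ≤ 1 :=
  Finset.card_le_one.2 fun _ _ _ _ => Subsingleton.elim _ _

lemma two_mul_card_gridBoxes_succ_le (a : ℕ → ℕ) (n : ℕ) :
    2 * (gridBoxes a (n + 1)).card ≤ (gridBoxes a n).card * a n ^ 2 := by
  have h : (gridBoxes a (n + 1)).card ≤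
      (gridBoxes a n ×ˢ ltPairs (Finset.range (a n))).card := by
    refine Finset.card_le_card_of_injOn
      (fun p => ((Fin.init p.1, Fin.init p.2), (p.1 (Fin.last n), p.2 (Fin.last n)))) ?_ ?_
    · intro p hp
      have hp' := mem_gridBoxes.1 hp
      have hl := hp' (Fin.last n)
      simp only [Fin.val_last] at hl
      simp only [Finset.coe_product, Set.mem_prod, Finset.mem_coe, mem_gridBoxes, ltPairs,
        Finset.mem_filter, Finset.mem_product, Finset.mem_range]
      exact ⟨fun i => hp' i.castSucc, ⟨hl.1.trans hl.2, hl.2⟩, hl.1⟩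
    · rintro ⟨p, q⟩ - ⟨p', q'⟩ - h
      simp only [Prod.mk.injEq] at h ⊢
      rw [← Fin.snoc_init_self p, ← Fin.snoc_init_self q, h.1.1, h.1.2, h.2.1, h.2.2]
      simp
  have h2 := two_mul_card_ltPairs (Finset.range (a n))
  rw [Finset.card_product] at h
  rw [Finset.card_range] at h2
  nlinarith

open Classical in
/-- The layers, among the first `m`, in which the box `x.1` has color `x.2`. -/
noncomputable def coloredLayers {n c : ℕ} (f : (Fin (n + 1) → ℕ) → Fin c) (m : ℕ)
    (x : ((Fin n → ℕ) × (Fin n → ℕ)) × Fin c) : Finset ℕ :=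
  (Finset.range m).filter fun y => BoxHasColor (layer f y) x.1 x.2

lemma sum_card_monoGridBoxes_layer_le (a : ℕ → ℕ) {n c : ℕ} (f : (Fin (n + 1) → ℕ) → Fin c) :
    ∑ y ∈ Finset.range (a n), (monoGridBoxes a (layer f y)).card ≤
      ∑ x ∈ gridBoxes a n ×ˢ (Finset.univ : Finset (Fin c)), (coloredLayers f (a n) x).card := by
  classical
  have hdc := Finset.sum_card_bipartiteAbove_eq_sum_card_bipartiteBelow
    (s := gridBoxes a n ×ˢ (Finset.univ : Finset (Fin c))) (t := Finset.range (a n))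
    fun x y => BoxHasColor (layer f y) x.1 x.2
  refine (Finset.sum_le_sum fun y _ => ?_).trans hdc.ge
  refine Finset.card_le_card_of_injOn (fun p => (p, layer f y p.1)) ?_ ?_
  · intro p hp
    obtain ⟨hp, s, hs⟩ := mem_monoGridBoxes.1 (Finset.mem_coe.1 hp)
    have : layer f y p.1 = s := hs _ fun i => Or.inl rfl
    subst this
    simpa [Finset.mem_bipartiteBelow, hp] using hs
  · intro p _ q _ h
    exact (Prod.mk.inj h).1

lemma sum_card_ltPairs_coloredLayers_le (a : ℕ → ℕ) {n c : ℕ}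
    (f : (Fin (n + 1) → ℕ) → Fin c) :
    ∑ x ∈ gridBoxes a n ×ˢ (Finset.univ : Finset (Fin c)),
      (ltPairs (coloredLayers f (a n) x)).card ≤ (monoGridBoxes a f).card := by
  classical
  rw [← Finset.card_sigma]
  refine Finset.card_le_card_of_injOn
    (fun z => (Fin.snoc z.1.1.1 z.2.1, Fin.snoc z.1.1.2 z.2.2)) ?_ ?_
  · rintro ⟨⟨⟨p, q⟩, s⟩, ⟨y, y'⟩⟩ hz
    simp only [Finset.coe_sigma, Set.mem_sigma_iff, Finset.mem_coe, Finset.mem_product,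
      Finset.mem_univ, and_true, ltPairs, coloredLayers, Finset.mem_filter,
      Finset.mem_range] at hz
    obtain ⟨hpq, ⟨⟨hy, hys⟩, hy', hys'⟩, hlt⟩ := hz
    refine Finset.mem_coe.2 (mem_monoGridBoxes.2 ⟨mem_gridBoxes.2 fun i => ?_, s, ?_⟩)
    · refine Fin.lastCases ?_ (fun i => ?_) i
      · simpa using ⟨hlt, hy'⟩
      · simpa using mem_gridBoxes.1 hpq i
    · intro x hx
      have hinit : ∀ i, Fin.init x i = p i ∨ Fin.init x i = q i := fun i => by
        simpa [Fin.init] using hx i.castSucc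
      rw [← Fin.snoc_init_self x]
      rcases hx (Fin.last n) with h | h <;> rw [h] <;> simp only [Fin.snoc_last]
      · exact hys _ hinit
      · exact hys' _ hinit
  · rintro ⟨⟨⟨p, q⟩, s⟩, ⟨y, y'⟩⟩ hz ⟨⟨⟨p₁, q₁⟩, s₁⟩, ⟨y₁, y₁'⟩⟩ hz₁ h
    simp only [Finset.coe_sigma, Set.mem_sigma_iff, Finset.mem_coe, Finset.mem_product,
      Finset.mem_univ, and_true, ltPairs, coloredLayers, Finset.mem_filter,
      Finset.mem_range] at hz hz₁
    simp only [Prod.mk.injEq, Fin.snoc_inj] at h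
    obtain ⟨⟨rfl, rfl⟩, rfl, rfl⟩ := h
    obtain rfl : s = s₁ := by
      rw [← hz.2.1.1.2 p fun i => Or.inl rfl, ← hz₁.2.1.1.2 p fun i => Or.inl rfl]
    rfl

/-- If a box and a color must be shared by two layers, there is a monochromatic box. -/
lemma monoGridBoxes_succ_nonempty {a : ℕ → ℕ} {n c : ℕ} (f : (Fin (n + 1) → ℕ) → Fin c)
    (hT : ∀ g : (Fin n → ℕ) → Fin c, 1 ≤ (monoGridBoxes a g).card)
    (ha : (gridBoxes a n).card * c < a n) : 1 ≤ (monoGridBoxes a f).card := by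
  have h1 := sum_card_monoGridBoxes_layer_le a f
  have h2 := sum_card_ltPairs_coloredLayers_le a f
  have h3 : a n ≤ ∑ y ∈ Finset.range (a n), (monoGridBoxes a (layer f y)).card := by
    simpa using Finset.card_nsmul_le_sum (Finset.range (a n)) _ 1 fun y _ => hT (layer f y)
  have h4 : ∑ x ∈ gridBoxes a n ×ˢ (Finset.univ : Finset (Fin c)),
      (coloredLayers f (a n) x).card ≤
      ∑ x ∈ gridBoxes a n ×ˢ (Finset.univ : Finset (Fin c)),
        ((ltPairs (coloredLayers f (a n) x)).card + 1) := by
    refine Finset.sum_le_sum fun x _ => ?_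
    have := two_mul_card_ltPairs (coloredLayers f (a n) x)
    generalize (coloredLayers f (a n) x).card = k at *
    zify at *
    nlinarith [sq_nonneg ((k : ℤ) - 1), sq_nonneg ((k : ℤ) - 2)]
  rw [Finset.sum_add_distrib, Finset.sum_const, Finset.card_product, Finset.card_univ,
    Fintype.card_fin, smul_eq_mul, mul_one] at h4
  omega

/-- A lower bound `1 / K` on the density of monochromatic boxes in every coloring passes to
the lower bound `1 / (2 c K ^ 2)` one dimension higher, if the new side is long enough. -/
lemma card_gridBoxes_succ_le {a : ℕ → ℕ} {n c K : ℕ}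
    (hT : ∀ g : (Fin n → ℕ) → Fin c, (gridBoxes a n).card ≤ K * (monoGridBoxes a g).card)
    (ha : 2 * c * K ≤ a n) (f : (Fin (n + 1) → ℕ) → Fin c) :
    (gridBoxes a (n + 1)).card ≤ 2 * c * K ^ 2 * (monoGridBoxes a f).card := by
  have h0 := two_mul_card_gridBoxes_succ_le a n
  have h1 := sum_card_monoGridBoxes_layer_le a f
  have h2 := sum_card_ltPairs_coloredLayers_le a f
  have h3 : a n * (gridBoxes a n).card ≤
      K * ∑ y ∈ Finset.range (a n), (monoGridBoxes a (layer f y)).card := by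
    rw [Finset.mul_sum]
    simpa using Finset.card_nsmul_le_sum (Finset.range (a n)) _ _ fun y _ => hT (layer f y)
  set X := gridBoxes a n ×ˢ (Finset.univ : Finset (Fin c)) with hX
  have hXc : X.card = (gridBoxes a n).card * c := by simp [hX]
  have hcs := sq_sum_le_card_mul_sum_sq (s := X) (f := fun x => (coloredLayers f (a n) x).card)
  have h4 : ∑ x ∈ X, (coloredLayers f (a n) x).card ^ 2 =
      2 * ∑ x ∈ X, (ltPairs (coloredLayers f (a n) x)).card +
        ∑ x ∈ X, (coloredLayers f (a n) x).card := by
    rw [Finset.mul_sum, ← Finset.sum_add_distrib]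
    exact Finset.sum_congr rfl fun x _ => (two_mul_card_ltPairs _).symm
  rw [h4, hXc] at hcs
  set S := ∑ x ∈ X, (coloredLayers f (a n) x).card
  set P := ∑ x ∈ X, (ltPairs (coloredLayers f (a n) x)).card
  set B := (gridBoxes a n).card
  set T := (monoGridBoxes a f).card
  have hKS : a n * B ≤ K * S := h3.trans (Nat.mul_le_mul_left K h1)
  rcases Nat.eq_zero_or_pos B with hB | hB
  · rw [hB] at h0
    omega
  rcases Nat.eq_zero_or_pos K with hK | hK
  · have : a n = 0 := by
      by_contra h
      have : 0 < a n * B := by positivity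
      rw [hK] at hKS
      omega
    rw [this] at h0
    omega
  have hS : 2 * (B * c) ≤ S := by
    refine le_of_mul_le_mul_left ?_ hK
    nlinarith [Nat.mul_le_mul_right B ha]
  have hST : S ^ 2 ≤ 4 * (B * c) * T := by
    have : 2 * (B * c) * P ≤ 2 * (B * c) * T := Nat.mul_le_mul_left _ h2
    nlinarith [Nat.mul_le_mul_right S hS]
  have hsq : (a n * B) ^ 2 ≤ (K * S) ^ 2 := Nat.pow_le_pow_left hKS 2
  have hB2 : B * (B * a n ^ 2) ≤ B * (4 * c * K ^ 2 * T) := by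
    nlinarith [Nat.mul_le_mul_left (K ^ 2) hST]
  have := le_of_mul_le_mul_left hB2 hB
  nlinarith

lemma three_pow_half_succ (j : ℕ) : (3 ^ (j + 1) - 1) / 2 = 3 * ((3 ^ j - 1) / 2) + 1 := by
  have h : Odd (3 ^ j) := Odd.pow (by decide)
  obtain ⟨k, hk⟩ := h
  rw [pow_succ, hk]
  omega

lemma mul_two_pow_le_three_pow_half (j : ℕ) : (j + 1) * 2 ^ j ≤ (3 ^ (j + 1) - 1) / 2 := by
  induction j with
  | zero => simp
  | succ j ih =>
    rw [three_pow_half_succ, pow_succ]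
    rcases j with _ | j
    · simp
    · nlinarith [Nat.zero_le (2 ^ (j + 1) * j)]

/-- The monochromatic boxes have positive density as soon as every side is long compared
with the densities obtained for the earlier sides. -/
lemma card_gridBoxes_le_pow {a : ℕ → ℕ} {c n₀ e n : ℕ} (hn : n₀ ≤ n) (he : 1 ≤ e)
    (hT : ∀ g : (Fin n₀ → ℕ) → Fin c,
      (gridBoxes a n₀).card ≤ (2 * c) ^ (e - 1) * (monoGridBoxes a g).card)
    (ha : ∀ k, n₀ + k < n → (2 * c) ^ (e * 2 ^ k) ≤ a (n₀ + k)) (f : (Fin n → ℕ) → Fin c) :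
    (gridBoxes a n).card ≤ (2 * c) ^ (e * 2 ^ (n - n₀) - 1) * (monoGridBoxes a f).card := by
  obtain ⟨k, rfl⟩ := Nat.exists_eq_add_of_le hn
  rw [Nat.add_sub_cancel_left]
  clear hn
  induction k with
  | zero => simpa using hT f
  | succ k ih =>
    have hpos : 1 ≤ e * 2 ^ k := Nat.one_le_iff_ne_zero.2 (by positivity)
    have h := card_gridBoxes_succ_le (ih fun i hi => ha i (by omega)) (by
      rw [← pow_succ', Nat.sub_add_cancel hpos]
      exact ha k (by omega)) f
    rw [← pow_mul, ← pow_succ'] at h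
    rwa [show e * 2 ^ (k + 1) - 1 = (e * 2 ^ k - 1) * 2 + 1 by
      rw [pow_succ, ← mul_assoc]; omega]

lemma prod_range_succ_le_pow {a : ℕ → ℕ} {j : ℕ} (hmono : ∀ i, i ≤ j → a i ≤ a j) :
    ∏ i ∈ Finset.range (j + 1), a i ≤ a j ^ (j + 1) := by
  simpa using Finset.prod_le_pow_card (Finset.range (j + 1)) a (a j) fun i hi =>
    hmono i (by simpa [Nat.lt_succ_iff] using hi)

lemma prod_range_succ_le_mul_pow {a : ℕ → ℕ} {j : ℕ} (hmono : ∀ i, i ≤ j → a i ≤ a j) :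
    ∏ i ∈ Finset.range (j + 1), a i ≤ a 0 * a j ^ j := by
  rw [Finset.prod_range_succ', mul_comm]
  refine Nat.mul_le_mul_left _ ?_
  simpa using Finset.prod_le_pow_card (Finset.range j) (fun i => a (i + 1)) (a j) fun i hi =>
    hmono _ (by simpa [Nat.succ_le_iff] using hi)

lemma monoGridBoxes_nonempty {a : ℕ → ℕ} {c n : ℕ} (hn : 1 ≤ n) (hc : 1 ≤ c) (h0 : c < a 0)
    (hmono : ∀ i j, i ≤ j → j < n → a i ≤ a j)
    (h : ∀ j, 1 ≤ j → j < n →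
      (2 * c) ^ ((3 ^ (j + 1) - 1) / 2) ≤ ∏ i ∈ Finset.range (j + 1), a i)
    (f : (Fin n → ℕ) → Fin c) : (monoGridBoxes a f).Nonempty := by
  have hboxes : 1 ≤ (gridBoxes a n).card := by
    refine Finset.card_pos.2 ⟨(fun _ => 0, fun _ => 1), mem_gridBoxes.2 fun i => ⟨one_pos, ?_⟩⟩
    have := hmono 0 i (Nat.zero_le _) i.2
    simp only
    omega
  have hpow {r s : ℕ} (hrs : r ≤ s) : (2 * c) ^ r ≤ (2 * c) ^ s :=
    Nat.pow_le_pow_right (by omega) hrs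
  have hzero (g : (Fin 0 → ℕ) → Fin c) : 1 ≤ (monoGridBoxes a g).card := by
    refine Finset.card_pos.2 ⟨(0, 0), mem_monoGridBoxes.2 ⟨mem_gridBoxes.2 fun i => i.elim0, g 0,
      fun x _ => congrArg g (Subsingleton.elim _ _)⟩⟩
  have hcard0 := card_gridBoxes_zero_le a
  suffices ∃ K, (gridBoxes a n).card ≤ K * (monoGridBoxes a f).card by
    obtain ⟨K, hK⟩ := this
    refine Finset.card_pos.1 (Nat.pos_of_ne_zero fun h => ?_)
    rw [h] at hK
    omega
  rcases le_or_gt (2 * c) (a 0) with hlarge | hsmall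
  · refine ⟨_, card_gridBoxes_le_pow (n₀ := 0) (e := 1) (Nat.zero_le n) le_rfl
      (fun g => ?_) (fun k hk => ?_) f⟩
    · simpa using hcard0.trans (hzero g)
    · rw [zero_add, one_mul] at *
      rcases Nat.eq_zero_or_pos k with rfl | hk0
      · simpa using hlarge
      refine (Nat.pow_le_pow_iff_left (n := k + 1) (by omega)).1 ?_
      rw [← pow_mul, mul_comm (2 ^ k)]
      exact (hpow (mul_two_pow_le_three_pow_half k)).trans
        ((h k hk0 hk).trans (prod_range_succ_le_pow fun i hi => hmono i k hi hk))
  · refine ⟨_, card_gridBoxes_le_pow (n₀ := 1) (e := 3) hn (by norm_num)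
      (fun g => ?_) (fun k hk => ?_) f⟩
    · have h1 := monoGridBoxes_succ_nonempty g hzero (by nlinarith)
      have h2 := two_mul_card_gridBoxes_succ_le a 0
      have h3 : a 0 ^ 2 ≤ (2 * c) ^ 2 := Nat.pow_le_pow_left hsmall.le 2
      simp only [Nat.reduceSub] at *
      nlinarith [Nat.mul_le_mul_right (a 0 ^ 2) hcard0, Nat.mul_le_mul_left ((2 * c) ^ 2) h1]
    · rw [add_comm 1 k] at *
      refine (Nat.pow_le_pow_iff_left (n := k + 1) (by omega)).1 ?_
      refine le_of_mul_le_mul_left ?_ (show 0 < 2 * c by omega)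
      calc 2 * c * ((2 * c) ^ (3 * 2 ^ k)) ^ (k + 1)
          = (2 * c) ^ (3 * ((k + 1) * 2 ^ k) + 1) := by rw [← pow_mul, pow_succ']; ring_nf
        _ ≤ (2 * c) ^ ((3 ^ (k + 1 + 1) - 1) / 2) := by
          rw [three_pow_half_succ (k + 1)]
          exact hpow (by have := mul_two_pow_le_three_pow_half k; omega)
        _ ≤ a 0 * a (k + 1) ^ (k + 1) := (h (k + 1) (by omega) hk).trans
          (prod_range_succ_le_mul_pow fun i hi => hmono i _ hi hk)
        _ ≤ 2 * c * a (k + 1) ^ (k + 1) := Nat.mul_le_mul_right _ hsmall.le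

lemma two_mul_pow_le {d c j : ℕ} (hj : 1 ≤ j) (hjd : j < d) :
    (2 * c) ^ ((3 ^ (j + 1) - 1) / 2) ≤
      (d * 2 ^ d) ^ (3 * (3 ^ j - 1) / 2) * c ^ ((3 ^ (j + 1) - 1) / 2) := by
  rw [mul_pow]
  refine Nat.mul_le_mul_right _ ?_
  have hD : 2 ^ 2 ≤ d * 2 ^ d := by
    have := Nat.pow_le_pow_right (n := 2) (by norm_num) (show 2 ≤ d by omega)
    nlinarith
  have h3 : 3 ≤ 3 ^ j := by simpa using Nat.pow_le_pow_right (n := 3) (by norm_num) hj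
  calc 2 ^ ((3 ^ (j + 1) - 1) / 2) ≤ 2 ^ (2 * (3 * (3 ^ j - 1) / 2)) :=
        Nat.pow_le_pow_right (by norm_num) (by rw [three_pow_half_succ]; omega)
    _ = (2 ^ 2) ^ (3 * (3 ^ j - 1) / 2) := pow_mul _ _ _
    _ ≤ _ := Nat.pow_le_pow_left hD _

/-- with `C_j = (d 2^d)^((3/2)(3^(j-1) - 1))`, if `a_1 ≤ ⋯ ≤ a_d` and
`∏_{i=1}^j a_i > C_j c^((3^j - 1)/2)` for all `j ∈ [d]`, then `[a_1,…,a_d]` is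
`c`-guaranteed.  (All the exponents here are integers, so the inequality is stated in `ℕ`.) -/
theorem hereditarily_large_guaranteed (d : ℕ) (hd : 1 ≤ d) (c : ℕ) (hc : 1 ≤ c)
    (a : Fin d → ℕ) (ha1 : ∀ i, 1 ≤ a i) (hmono : ∀ i j : Fin d, i ≤ j → a i ≤ a j)
    (h : ∀ j : ℕ, 1 ≤ j → j ≤ d →
      (d * 2 ^ d) ^ (3 * (3 ^ (j - 1) - 1) / 2) * c ^ ((3 ^ j - 1) / 2)
        < ∏ i ∈ Finset.univ.filter (fun i : Fin d => (i : ℕ) < j), a i) :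
    Guaranteed d a c 1 := by
  intro f
  let b : ℕ → ℕ := fun i => if hi : i < d then a ⟨i, hi⟩ else 0
  have hb (i : Fin d) : b i = a i := by simp [b]
  have hprod (j : ℕ) (hj : j ≤ d) :
      ∏ i ∈ Finset.univ.filter (fun i : Fin d => (i : ℕ) < j), a i =
        ∏ i ∈ Finset.range j, b i := by
    refine Finset.prod_bij (fun i _ => (i : ℕ)) (by simp) (fun i _ k _ hik => Fin.ext hik)
      (fun i hi => ⟨⟨i, (Finset.mem_range.1 hi).trans_le hj⟩, by simpa using hi, rfl⟩)
      fun i _ => (hb i).symm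
  have h0 : c < b 0 := by
    have := h 1 le_rfl hd
    rw [hprod 1 hd] at this
    simpa using this
  have hbmono : ∀ i j, i ≤ j → j < d → b i ≤ b j := fun i j hij hj => by
    have := hmono ⟨i, hij.trans_lt hj⟩ ⟨j, hj⟩ hij
    rwa [← hb, ← hb] at this
  have hbprod : ∀ j, 1 ≤ j → j < d →
      (2 * c) ^ ((3 ^ (j + 1) - 1) / 2) ≤ ∏ i ∈ Finset.range (j + 1), b i := fun j hj hjd => by
    have := h (j + 1) (by omega) hjd
    rw [hprod _ hjd, Nat.add_sub_cancel] at this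
    exact (two_mul_pow_le hj hjd).trans this.le
  let F : (Fin d → ℕ) → Fin c := fun x =>
    f fun i => if hx : x i < a i then ⟨x i, hx⟩ else ⟨0, ha1 i⟩
  obtain ⟨p, hp⟩ := monoGridBoxes_nonempty hd hc h0 hbmono hbprod F
  obtain ⟨hp, s, hs⟩ := mem_monoGridBoxes.1 hp
  have hp' : ∀ i, p.1 i < p.2 i ∧ p.2 i < a i := fun i => by
    simpa only [hb] using mem_gridBoxes.1 hp i
  have : Finite (GridPoint d a) := inferInstanceAs (Finite ((i : Fin d) → Fin (a i)))
  refine (Set.ncard_pos (Set.toFinite _)).2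
    ⟨(fun i => ⟨p.1 i, (hp' i).1.trans (hp' i).2⟩, fun i => ⟨p.2 i, (hp' i).2⟩),
      fun i => (hp' i).1, s, fun x hx => ?_⟩
  have hFx : F (fun i => (x i : ℕ)) = f x := by simp [F]
  rw [← hFx]
  exact hs _ fun i => (hx i).imp (congrArg Fin.val) (congrArg Fin.val)
end
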